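/- Let V be an n-dimensional K-vector space with n ≥ 2, u ∈ GL(V) unipotent with Jordan block sizes d_1, …, d_t on V (t ≥ 1), and set α = ν₂(gcd(d_1,…,d_t)). Let λ(d) and λ'(d) be the Jordan block multiplicities of u on V⊗V* and on the subquotient ⟨γ_V⟩^⊥/⟨γ_V⟩ respectively, and let ε = ε_{V⊗V*, b_V} and ε' = ε on the subquotient with the induced form. Then: (i) if n is odd, λ'(1) = λ(1) − 1 and λ'(d) = λ(d) for all d > 1; (ii) if n is even and α = 0, λ'(1) = λ(1) − 2 and λ'(d) = λ(d) for all d > 1; (iii) if n is even and α > 0: (a) if 2 divides n/2^α, then λ'(2^α) = λ(2^α) − 2, λ'(2^α − 1) = 2, and λ'(d) = λ(d) for all d ≠ 2^α, 2^α − 1; (b) if α > 1 and 2 does not divide n/2^α, then λ'(2^α) = λ(2^α) − 1, λ'(2^α − 2) = 1, and λ'(d) = λ(d) for all d ≠ 2^α, 2^α − 2; (c) if α = 1 and 2 does not divide n/2, then λ'(2) = λ(2) − 1 and λ'(d) = λ(d) for all d ≠ 2. Moreover: if case (iii)(b) holds, then ε(2^α − 2) = 0, ε'(2^α − 2) = 1,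 and ε'(d) = ε(d) for all d ≠ 2^α − 2; if case (iii)(b) does not hold, then ε'(d) = ε(d) for all d ≥ 1. -/

import Mathlib

set_option maxSynthPendingDepth 3

open Module LinearMap

noncomputable section

/-- Multiplicity of a Jordan block of size `d` of a unipotent map `u`, computed from
`f = u - 1` as `rank f^(d-1) - 2 rank f^d + rank f^(d+1)`. -/
def jordanMult (K : Type*) [Field K] {V : Type*} [AddCommGroup V] [Module K V]
    (f : V →ₗ[K] V) (d : ℕ) : ℕ :=
  Module.finrank K (LinearMap.range (f ^ (d - 1))) +
    Module.finrank K (LinearMap.range (f ^ (d + 1))) -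
    2 * Module.finrank K (LinearMap.range (f ^ d))

open Classical in
/-- The invariant ε_{V,b}(d) of Hesselink/Spaltenstein, computed from `f = u - 1`. -/
def eps (K : Type*) [Field K] {V : Type*} [AddCommGroup V] [Module K V]
    (f : V →ₗ[K] V) (b : V →ₗ[K] V →ₗ[K] K) (d : ℕ) : ℕ :=
  if ∃ v : V, (f ^ d) v = 0 ∧ b ((f ^ (d - 1)) v) v ≠ 0 then 1 else 0

/-- A linear endomorphism is unipotent if `(f - 1)^N = 0` for some `N`. -/
def IsUnipotent (K : Type*) [Field K] {V : Type*} [AddCommGroup V] [Module K V]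
    (f : V →ₗ[K] V) : Prop :=
  ∃ N : ℕ, (f - 1) ^ N = 0

/-- The standard single unipotent Jordan block of size `m` over `K`. -/
def jordanBlockMap (K : Type*) [Field K] (m : ℕ) : (Fin m → K) →ₗ[K] (Fin m → K) :=
  Matrix.toLin' (1 + Matrix.of fun i j : Fin m => if (i : ℕ) + 1 = (j : ℕ) then 1 else 0)

end

section Abstract

variable {K : Type*} [Field K]

lemma finrank_comap_subtype {A : Type*} [AddCommGroup A] [Module K A]
    (P L : Submodule K A) :
    finrank K ↥(L.comap P.subtype) = finrank K ↥(P ⊓ L) := by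
  rw [← Submodule.finrank_map_subtype_eq, Submodule.map_comap_subtype]

lemma rank_step {A : Type*} [AddCommGroup A] [Module K A] [FiniteDimensional K A]
    (X : A →ₗ[K] A) (d : ℕ) :
    finrank K (range (X ^ (d + 1))) + finrank K ↥(ker X ⊓ range (X ^ d)) =
      finrank K (range (X ^ d)) := by
  have h := LinearMap.finrank_range_add_finrank_ker (X.comp (range (X ^ d)).subtype)
  have h1 : range (X.comp (range (X ^ d)).subtype) = range (X ^ (d + 1)) := by
    rw [LinearMap.range_comp, Submodule.range_subtype, pow_succ', Module.End.mul_eq_comp,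
      LinearMap.range_comp]
  have h2 : finrank K (ker (X.comp (range (X ^ d)).subtype)) =
      finrank K ↥(ker X ⊓ range (X ^ d)) := by
    rw [LinearMap.ker_comp]
    rw [finrank_comap_subtype, inf_comm]
  rw [h1, h2] at h
  exact h

lemma rank_convex {A : Type*} [AddCommGroup A] [Module K A] [FiniteDimensional K A]
    (X : A →ₗ[K] A) (d : ℕ) :
    2 * finrank K (range (X ^ (d + 1))) ≤
      finrank K (range (X ^ d)) + finrank K (range (X ^ (d + 2))) := by
  have h1 := rank_step X d
  have h2 := rank_step X (d + 1)
  rw [show d + 1 + 1 = d + 2 from rfl] at h2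
  have h3 : finrank K ↥(ker X ⊓ range (X ^ (d + 1))) ≤ finrank K ↥(ker X ⊓ range (X ^ d)) := by
    apply Submodule.finrank_mono
    apply inf_le_inf_left
    rw [pow_succ, Module.End.mul_eq_comp]
    exact LinearMap.range_comp_le_range _ _
  omega

lemma rank_linear {A : Type*} [AddCommGroup A] [Module K A] [FiniteDimensional K A]
    (X : A →ₗ[K] A) (q : ℕ) (hker : ∀ z, X z = 0 → ∃ y, (X ^ (q - 1)) y = z)
    (d : ℕ) (hd : d + 1 < q) :
    2 * finrank K (range (X ^ (d + 1))) =
      finrank K (range (X ^ d)) + finrank K (range (X ^ (d + 2))) := by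
  have h1 := rank_step X d
  have h2 := rank_step X (d + 1)
  rw [show d + 1 + 1 = d + 2 from rfl] at h2
  have key : ∀ e, e < q → ker X ⊓ range (X ^ e) = ker X := by
    intro e he
    rw [inf_eq_left]
    intro z hz
    obtain ⟨y, hy⟩ := hker z hz
    refine ⟨(X ^ (q - 1 - e)) y, ?_⟩
    rw [← Module.End.mul_apply, ← pow_add, ← hy]
    congr 2; omega
  rw [key _ (by omega)] at h1
  rw [key _ (by omega)] at h2
  omega

/-- rank of the map on the subquotient, through the kernel. -/
lemma rank_quot {A : Type*} [AddCommGroup A] [Module K A] [FiniteDimensional K A]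
    (X : A →ₗ[K] A) (P : Submodule K A) (γ : A) (Q : Type*) [AddCommGroup Q] [Module K Q]
    (π : P →ₗ[K] Q) (hπ : Function.Surjective π)
    (hker : ∀ x : P, π x = 0 ↔ (x : A) ∈ Submodule.span K {γ})
    (hXP : ∀ x ∈ P, X x ∈ P) (XQ : Q →ₗ[K] Q)
    (hXQ : ∀ x : P, XQ (π x) = π ⟨X x, hXP _ x.2⟩) (d : ℕ) :
    finrank K (range (XQ ^ d)) +
      finrank K ↥(P ⊓ (Submodule.span K {γ}).comap (X ^ d)) = finrank K P := by
  have hXPd : ∀ d, ∀ x ∈ P, (X ^ d) x ∈ P := by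
    intro d
    induction d with
    | zero => intro x hx; simpa using hx
    | succ d ih => intro x hx; rw [pow_succ', Module.End.mul_apply]; exact hXP _ (ih x hx)
  have hXQd : ∀ d, ∀ x : P, (XQ ^ d) (π x) = π ⟨(X ^ d) x, hXPd d _ x.2⟩ := by
    intro d
    induction d with
    | zero => intro x; simp
    | succ d ih =>
      intro x
      rw [pow_succ', Module.End.mul_apply, ih, hXQ]
      congr 1
      exact Subtype.ext (by simp only [pow_succ', Module.End.mul_apply])
  have h := LinearMap.finrank_range_add_finrank_ker ((XQ ^ d).comp π)
  rw [LinearMap.range_comp_of_range_eq_top _ (LinearMap.range_eq_top.2 hπ)] at h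
  rw [← h]
  congr 1
  have e1 : ker ((XQ ^ d).comp π) =
      ((Submodule.span K {γ}).comap (X ^ d)).comap P.subtype := by
    ext x
    simp only [LinearMap.mem_ker, LinearMap.comp_apply, Submodule.mem_comap, Submodule.subtype_apply]
    rw [hXQd, hker]
  rw [e1, finrank_comap_subtype]

lemma comap_dim_hit {A : Type*} [AddCommGroup A] [Module K A] [FiniteDimensional K A]
    (X : A →ₗ[K] A) (P : Submodule K A) (γ : A) (hγ : γ ≠ 0)
    (hk : ker X ≤ P) (hy : ∃ y ∈ P, X y = γ) :
    finrank K ↥(P ⊓ (Submodule.span K {γ}).comap X) = finrank K (ker X) + 1 := by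
  obtain ⟨y, hyP, hy⟩ := hy
  have e : P ⊓ (Submodule.span K {γ}).comap X = ker X ⊔ Submodule.span K {y} := by
    apply le_antisymm
    · rintro x ⟨-, hx⟩
      obtain ⟨c, hc⟩ := Submodule.mem_span_singleton.1 hx
      rw [Submodule.mem_sup]
      refine ⟨x - c • y, ?_, c • y, Submodule.smul_mem _ _ (Submodule.mem_span_singleton_self y), by simp⟩
      simp [hy, hc]
    · apply sup_le
      · refine le_inf hk ?_
        intro x hx
        simp [LinearMap.mem_ker.1 hx]
      · rw [Submodule.span_singleton_le_iff_mem]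
        exact ⟨hyP, by simp [hy, Submodule.mem_span_singleton_self]⟩
  have hd : ker X ⊓ Submodule.span K {y} = ⊥ := by
    rw [eq_bot_iff]
    rintro x ⟨hx, hx'⟩
    obtain ⟨c, rfl⟩ := Submodule.mem_span_singleton.1 hx'
    have : c • γ = 0 := by simpa [hy] using LinearMap.mem_ker.1 hx
    rcases smul_eq_zero.1 this with h | h
    · simp [h]
    · exact absurd h hγ
  have hs := Submodule.finrank_sup_add_finrank_inf_eq (ker X) (Submodule.span K {y})
  have hy0 : y ≠ 0 := by rintro rfl; simp at hy; exact hγ hy.symm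
  rw [hd, finrank_bot, finrank_span_singleton hy0] at hs
  rw [e]; omega

lemma comap_miss {A : Type*} [AddCommGroup A] [Module K A]
    (X : A →ₗ[K] A) (P : Submodule K A) (γ : A)
    (hy : ∀ y ∈ P, X y ≠ γ) :
    P ⊓ (Submodule.span K {γ}).comap X = P ⊓ ker X := by
  apply le_antisymm
  · rintro x ⟨hxP, hx⟩
    refine ⟨hxP, ?_⟩
    obtain ⟨c, hc⟩ := Submodule.mem_span_singleton.1 hx
    by_cases h0 : c = 0
    · subst h0; simpa using hc.symm
    · exfalso
      apply hy (c⁻¹ • x) (P.smul_mem _ hxP)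
      rw [map_smul, ← hc, smul_smul, inv_mul_cancel₀ h0, one_smul]
  · rintro x ⟨hxP, hx⟩
    exact ⟨hxP, by simp [LinearMap.mem_ker.1 hx]⟩

lemma ker_inf_dim {A : Type*} [AddCommGroup A] [Module K A] [FiniteDimensional K A]
    (X : A →ₗ[K] A) (ψ : A →ₗ[K] K) (h : ∃ z, X z = 0 ∧ ψ z ≠ 0) :
    finrank K ↥(ker ψ ⊓ ker X) + 1 = finrank K (ker X) := by
  obtain ⟨z, hz, hz'⟩ := h
  have h := LinearMap.finrank_range_add_finrank_ker (ψ.comp (ker X).subtype)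
  have h1 : range (ψ.comp (ker X).subtype) = ⊤ := by
    rw [LinearMap.range_eq_top]
    intro c
    refine ⟨(c / ψ z) • ⟨z, hz⟩, ?_⟩
    simp [hz']
  rw [h1, finrank_top, finrank_self, LinearMap.ker_comp,
    finrank_comap_subtype, inf_comm] at h
  omega

lemma ker_dim {A : Type*} [AddCommGroup A] [Module K A] [FiniteDimensional K A]
    (ψ : A →ₗ[K] K) (h : ∃ z, ψ z ≠ 0) :
    finrank K (ker ψ) + 1 = finrank K A := by
  obtain ⟨z, hz⟩ := h
  have := ker_inf_dim (0 : A →ₗ[K] A) ψ ⟨z, rfl, hz⟩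
  rwa [LinearMap.ker_zero, inf_top_eq, finrank_top] at this

end Abstract

section Forms

set_option linter.unusedSectionVars false

variable {K : Type*} [Field K] [CharP K 2] {A : Type*} [AddCommGroup A] [Module K A]

lemma form_shift_one (g : A →ₗ[K] A) (b : A →ₗ[K] A →ₗ[K] K)
    (hinv : ∀ x y, b (g x) (g y) = b x y) (w z : A) :
    b w ((g - 1) z) = b ((g - 1) w) (g z) := by
  simp only [LinearMap.sub_apply, Module.End.one_apply, map_sub, hinv]
  rw [CharTwo.sub_eq_add, CharTwo.sub_eq_add, add_comm]

lemma comm_g_X (g : A →ₗ[K] A) (k l : ℕ) (x : A) :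
    (g ^ k) (((g - 1) ^ l) x) = ((g - 1) ^ l) ((g ^ k) x) := by
  have : Commute g (g - 1) := (Commute.refl g).sub_right (Commute.one_right g)
  have h := (this.pow_pow k l).eq
  rw [← Module.End.mul_apply, h, Module.End.mul_apply]

lemma form_shift (g : A →ₗ[K] A) (b : A →ₗ[K] A →ₗ[K] K)
    (hinv : ∀ x y, b (g x) (g y) = b x y) (k l : ℕ) (x y : A) :
    b (((g - 1) ^ k) x) (((g - 1) ^ l) y) = b (((g - 1) ^ (k + l)) x) ((g ^ l) y) := by
  induction l generalizing k y with
  | zero => simp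
  | succ l ih =>
    rw [pow_succ' _ l, Module.End.mul_apply, form_shift_one g b hinv, ← Module.End.mul_apply,
      ← pow_succ']
    have h := comm_g_X g 1 l y
    rw [pow_one] at h
    rw [h, ih (k + 1) (g y), pow_succ, Module.End.mul_apply]
    rw [show k + 1 + l = k + (l + 1) by ring]

lemma form_vanish (g : A →ₗ[K] A) (b : A →ₗ[K] A →ₗ[K] K)
    (hinv : ∀ x y, b (g x) (g y) = b x y) (k : ℕ) (x y : A) (hx : ((g - 1) ^ k) x = 0) :
    b x (((g - 1) ^ k) y) = 0 := by
  have := form_shift g b hinv 0 k x y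
  rw [zero_add, hx] at this
  simpa using this

lemma pow_eq_zero_of_le' (X : A →ₗ[K] A) {k l : ℕ} (h : k ≤ l) (x : A) (hx : (X ^ k) x = 0) :
    (X ^ l) x = 0 := by
  obtain ⟨m, rfl⟩ := Nat.exists_eq_add_of_le' h
  rw [pow_add, Module.End.mul_apply, hx, map_zero]

lemma form_g_pow (g : A →ₗ[K] A) (b : A →ₗ[K] A →ₗ[K] K)
    (hinv : ∀ x y, b (g x) (g y) = b x y) (γ : A) (hγ : g γ = γ) (k : ℕ) (x : A) :
    b γ ((g ^ k) x) = b γ x := by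
  induction k with
  | zero => simp
  | succ k ih =>
    rw [pow_succ', Module.End.mul_apply]
    conv_lhs => rw [← hγ]
    rw [hinv, ih]

lemma form_γ_X (g : A →ₗ[K] A) (b : A →ₗ[K] A →ₗ[K] K)
    (hinv : ∀ x y, b (g x) (g y) = b x y) (γ : A) (hγ : g γ = γ) (x : A) :
    b γ ((g - 1) x) = 0 := by
  have := form_g_pow g b hinv γ hγ 1 x
  rw [pow_one] at this
  simp [this]

lemma form_odd (g : A →ₗ[K] A) (b : A →ₗ[K] A →ₗ[K] K)
    (hinv : ∀ x y, b (g x) (g y) = b x y) (hsymm : ∀ x y, b x y = b y x)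
    (halt : ∀ x, b x x = 0) (γ : A) (hγ : g γ = γ) (m : ℕ) (x : A)
    (hx : ((g - 1) ^ (2 * m + 1)) x ∈ Submodule.span K {γ}) (hx' : b γ x = 0) :
    b (((g - 1) ^ (2 * m)) x) x = 0 := by
  obtain ⟨c, hc⟩ := Submodule.mem_span_singleton.1 hx
  have key : ∀ j, b (((g - 1) ^ m) x) ((g ^ j) (((g - 1) ^ m) x)) = 0 := by
    intro j
    induction j with
    | zero => simpa using halt _
    | succ j ih =>
      have e : (g ^ (j + 1)) (((g - 1) ^ m) x) = (g ^ j) (((g - 1) ^ m) x) +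
          (g - 1) ((g ^ j) (((g - 1) ^ m) x)) := by
        rw [pow_succ', Module.End.mul_apply]; simp
      rw [e, map_add, ih, zero_add, form_shift_one g b hinv, ← Module.End.mul_apply,
        ← Module.End.mul_apply g, ← pow_succ', ← pow_succ', comm_g_X, form_shift g b hinv,
        show m + 1 + m = 2 * m + 1 by ring, ← hc, map_smul, LinearMap.smul_apply,
        form_g_pow g b hinv γ hγ, form_g_pow g b hinv γ hγ, hx', smul_zero]
  have h := form_shift g b hinv 0 m x (((g - 1) ^ m) x)
  rw [pow_zero, zero_add, ← Module.End.mul_apply, ← pow_add, ← two_mul] at h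
  rw [hsymm]
  simp only [Module.End.one_apply] at h
  rw [h, key]

end Forms

section Quot

variable {K : Type*} [Field K] {A : Type*} [AddCommGroup A] [Module K A]

lemma pow_mem_sub (X : A →ₗ[K] A) (P : Submodule K A) (hXP : ∀ x ∈ P, X x ∈ P) (d : ℕ) :
    ∀ x ∈ P, (X ^ d) x ∈ P := by
  induction d with
  | zero => intro x hx; simpa using hx
  | succ d ih => intro x hx; rw [pow_succ', Module.End.mul_apply]; exact hXP _ (ih x hx)

lemma quot_pow (X : A →ₗ[K] A) (P : Submodule K A) (Q : Type*) [AddCommGroup Q] [Module K Q]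
    (π : P →ₗ[K] Q)
    (hXP : ∀ x ∈ P, X x ∈ P) (XQ : Q →ₗ[K] Q)
    (hXQ : ∀ x : P, XQ (π x) = π ⟨X x, hXP _ x.2⟩) (d : ℕ) (x : P) :
    (XQ ^ d) (π x) = π ⟨(X ^ d) x, pow_mem_sub X P hXP d _ x.2⟩ := by
  induction d with
  | zero => simp
  | succ d ih =>
    rw [pow_succ', Module.End.mul_apply, ih, hXQ]
    congr 1
    exact Subtype.ext (by simp only [pow_succ', Module.End.mul_apply])

lemma eps_quot (X : A →ₗ[K] A) (b : A →ₗ[K] A →ₗ[K] K) (P : Submodule K A) (γ : A)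
    (Q : Type*) [AddCommGroup Q] [Module K Q]
    (π : P →ₗ[K] Q) (hπ : Function.Surjective π)
    (hker : ∀ x : P, π x = 0 ↔ (x : A) ∈ Submodule.span K {γ})
    (hXP : ∀ x ∈ P, X x ∈ P) (XQ : Q →ₗ[K] Q)
    (hXQ : ∀ x : P, XQ (π x) = π ⟨X x, hXP _ x.2⟩)
    (bQ : Q →ₗ[K] Q →ₗ[K] K) (hbQ : ∀ x y : P, bQ (π x) (π y) = b x y) (d : ℕ) :
    (∃ v : Q, (XQ ^ d) v = 0 ∧ bQ ((XQ ^ (d - 1)) v) v ≠ 0) ↔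
      ∃ x ∈ P, (X ^ d) x ∈ Submodule.span K {γ} ∧ b ((X ^ (d - 1)) x) x ≠ 0 := by
  constructor
  · rintro ⟨v, h1, h2⟩
    obtain ⟨x, rfl⟩ := hπ v
    rw [quot_pow X P Q π hXP XQ hXQ] at h1 h2
    rw [hker] at h1
    rw [hbQ] at h2
    exact ⟨x, x.2, h1, h2⟩
  · rintro ⟨x, hx, h1, h2⟩
    refine ⟨π ⟨x, hx⟩, ?_, ?_⟩
    · rw [quot_pow X P Q π hXP XQ hXQ, hker]; exact h1
    · rw [quot_pow X P Q π hXP XQ hXQ, hbQ]; exact h2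

lemma eps_one {V : Type*} [AddCommGroup V] [Module K V]
    (f : V →ₗ[K] V) (b : V →ₗ[K] V →ₗ[K] K) (d : ℕ)
    (h : ∃ v, (f ^ d) v = 0 ∧ b ((f ^ (d - 1)) v) v ≠ 0) : eps K f b d = 1 := by
  unfold eps
  rw [if_pos h]

lemma eps_zero {V : Type*} [AddCommGroup V] [Module K V]
    (f : V →ₗ[K] V) (b : V →ₗ[K] V →ₗ[K] K) (d : ℕ)
    (h : ¬ ∃ v, (f ^ d) v = 0 ∧ b ((f ^ (d - 1)) v) v ≠ 0) : eps K f b d = 0 := by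
  unfold eps
  rw [if_neg h]

lemma eps_congr {V V' : Type*} [AddCommGroup V] [Module K V] [AddCommGroup V'] [Module K V']
    (f : V →ₗ[K] V) (b : V →ₗ[K] V →ₗ[K] K) (f' : V' →ₗ[K] V') (b' : V' →ₗ[K] V' →ₗ[K] K) (d : ℕ)
    (h : (∃ v, (f ^ d) v = 0 ∧ b ((f ^ (d - 1)) v) v ≠ 0) ↔
      (∃ v, (f' ^ d) v = 0 ∧ b' ((f' ^ (d - 1)) v) v ≠ 0)) : eps K f b d = eps K f' b' d := by
  by_cases h1 : ∃ v, (f ^ d) v = 0 ∧ b ((f ^ (d - 1)) v) v ≠ 0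
  · rw [eps_one _ _ _ h1, eps_one _ _ _ (h.1 h1)]
  · rw [eps_zero _ _ _ h1, eps_zero _ _ _ (fun h2 => h1 (h.2 h2))]

end Quot

section Main

variable {K : Type*} [Field K] [CharP K 2] {A : Type*} [AddCommGroup A] [Module K A]
  [FiniteDimensional K A]

/-- `n` odd -/
lemma abs_odd (g : A →ₗ[K] A) (b : A →ₗ[K] A →ₗ[K] K) (ψ : A →ₗ[K] K)
    (halt : ∀ x, b x x = 0) (γ : A) (hγ : g γ = γ) (hbγ : ∀ x, b x γ = 0) (hγ0 : ψ γ ≠ 0)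
    (hψ : ∀ x, ψ (g x) = ψ x)
    (P : Submodule K A) (hP : P = ⊤) (Q : Type*) [AddCommGroup Q] [Module K Q]
    (π : P →ₗ[K] Q) (hπ : Function.Surjective π)
    (hker : ∀ x : P, π x = 0 ↔ (x : A) ∈ Submodule.span K {γ})
    (hXP : ∀ x ∈ P, (g - 1) x ∈ P) (XQ : Q →ₗ[K] Q)
    (hXQ : ∀ x : P, XQ (π x) = π ⟨(g - 1) x, hXP _ x.2⟩)
    (bQ : Q →ₗ[K] Q →ₗ[K] K) (hbQ : ∀ x y : P, bQ (π x) (π y) = b x y) :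
    (jordanMult K XQ 1 + 1 = jordanMult K (g - 1) 1 ∧
      ∀ d, 1 < d → jordanMult K XQ d = jordanMult K (g - 1) d) ∧
    ∀ d, 1 ≤ d → eps K XQ bQ d = eps K (g - 1) b d := by
  have hγne : γ ≠ 0 := by rintro rfl; simp at hγ0
  have : FiniteDimensional K Q := Module.Finite.of_surjective π hπ
  have hXγ : (g - 1) γ = 0 := by simp [hγ]
  have hψX : ∀ x, ψ ((g - 1) x) = 0 := by intro x; simp [hψ]
  have miss : ∀ d : ℕ, ∀ y, ((g - 1) ^ (d + 1)) y ≠ γ := by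
    intro d y h
    rw [pow_succ', Module.End.mul_apply] at h
    exact hγ0 (by rw [← h, hψX])
  have R := rank_quot (g - 1) P γ Q π hπ hker hXP XQ hXQ
  have N : ∀ d, finrank K (range ((g - 1) ^ d)) + finrank K (ker ((g - 1) ^ d)) = finrank K A :=
    fun d => LinearMap.finrank_range_add_finrank_ker _
  have hPA : finrank K P = finrank K A := by rw [hP, finrank_top]
  have r0 : finrank K (range (XQ ^ 0)) + 1 = finrank K (range ((g - 1) ^ 0)) := by
    have h1 := comap_dim_hit ((g - 1) ^ 0) P γ hγne (by simp [hP])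
      ⟨γ, by simp [hP], by simp⟩
    have := R 0
    have := N 0
    omega
  have r1 : ∀ d, finrank K (range (XQ ^ (d + 1))) = finrank K (range ((g - 1) ^ (d + 1))) := by
    intro d
    have h1 := comap_miss ((g - 1) ^ (d + 1)) P γ (fun y _ => miss d y)
    have h2 := R (d + 1)
    have := N (d + 1)
    rw [h1, hP, top_inf_eq, finrank_top] at h2
    omega
  refine ⟨⟨?_, ?_⟩, ?_⟩
  · have c1 := rank_convex XQ 0
    have c2 := rank_convex (g - 1) 0
    have e1 := r1 0
    have e2 := r1 1
    unfold jordanMult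
    simp only [zero_add, Nat.reduceAdd] at *
    rw [show (1 - 1 : ℕ) = 0 from rfl]
    omega
  · intro d hd
    obtain ⟨d, rfl⟩ := Nat.exists_eq_add_of_le' hd
    unfold jordanMult
    rw [show d + (1 + 1) - 1 = d + 1 by omega, r1,
      show d + (1 + 1) + 1 = (d + 1 + 1) + 1 by omega, r1,
      show d + (1 + 1) = (d + 1) + 1 by omega, r1]
  · intro d hd
    apply eps_congr
    rw [eps_quot (g - 1) b P γ Q π hπ hker hXP XQ hXQ bQ hbQ]
    obtain ⟨d, rfl⟩ := Nat.exists_eq_add_of_le' hd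
    constructor
    · rintro ⟨x, -, h1, h2⟩
      refine ⟨x, ?_, h2⟩
      have h3 : x ∈ P ⊓ (Submodule.span K {γ}).comap ((g - 1) ^ (d + 1)) := ⟨by simp [hP], h1⟩
      rw [comap_miss ((g - 1) ^ (d + 1)) P γ (fun y _ => miss d y)] at h3
      exact h3.2
    · rintro ⟨x, h1, h2⟩
      exact ⟨x, by simp [hP], by simp [h1], h2⟩

/-- `n` even, `α = 0` -/
lemma abs_even_zero (g : A →ₗ[K] A) (b : A →ₗ[K] A →ₗ[K] K)
    (hinv : ∀ x y, b (g x) (g y) = b x y) (hsymm : ∀ x y, b x y = b y x)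
    (halt : ∀ x, b x x = 0) (γ : A) (hγ : g γ = γ) (z : A) (hz : (g - 1) z = 0)
    (hz1 : b γ z = 1)
    (P : Submodule K A) (hP : P = ker (b γ)) (Q : Type*) [AddCommGroup Q] [Module K Q]
    (π : P →ₗ[K] Q) (hπ : Function.Surjective π)
    (hker : ∀ x : P, π x = 0 ↔ (x : A) ∈ Submodule.span K {γ})
    (hXP : ∀ x ∈ P, (g - 1) x ∈ P) (XQ : Q →ₗ[K] Q)
    (hXQ : ∀ x : P, XQ (π x) = π ⟨(g - 1) x, hXP _ x.2⟩)
    (bQ : Q →ₗ[K] Q →ₗ[K] K) (hbQ : ∀ x y : P, bQ (π x) (π y) = b x y) :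
    (jordanMult K XQ 1 + 2 = jordanMult K (g - 1) 1 ∧
      ∀ d, 1 < d → jordanMult K XQ d = jordanMult K (g - 1) d) ∧
    ∀ d, 1 ≤ d → eps K XQ bQ d = eps K (g - 1) b d := by
  have hγne : γ ≠ 0 := by rintro rfl; simp at hz1
  have : FiniteDimensional K Q := Module.Finite.of_surjective π hπ
  have hzd : ∀ d : ℕ, ((g - 1) ^ (d + 1)) z = 0 := by
    intro d; rw [pow_succ, Module.End.mul_apply, hz, map_zero]
  have miss : ∀ d : ℕ, ∀ y, ((g - 1) ^ (d + 1)) y ≠ γ := by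
    intro d y h
    have := form_vanish g b hinv (d + 1) z y (hzd d)
    rw [h, hsymm, hz1] at this
    exact one_ne_zero this
  have R := rank_quot (g - 1) P γ Q π hπ hker hXP XQ hXQ
  have N : ∀ d, finrank K (range ((g - 1) ^ d)) + finrank K (ker ((g - 1) ^ d)) = finrank K A :=
    fun d => LinearMap.finrank_range_add_finrank_ker _
  have hPA : finrank K P + 1 = finrank K A := by
    rw [hP]; exact ker_dim (b γ) ⟨z, by simp [hz1]⟩
  have r0 : finrank K (range (XQ ^ 0)) + 2 = finrank K (range ((g - 1) ^ 0)) := by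
    have h1 := comap_dim_hit ((g - 1) ^ 0) P γ hγne
      (by simp [Module.End.one_eq_id, LinearMap.ker_id])
      ⟨γ, by simp [hP, halt], by simp⟩
    have := R 0
    have := N 0
    omega
  have r1 : ∀ d, finrank K (range (XQ ^ (d + 1))) = finrank K (range ((g - 1) ^ (d + 1))) := by
    intro d
    have h1 := comap_miss ((g - 1) ^ (d + 1)) P γ (fun y _ => miss d y)
    have h2 := R (d + 1)
    have := N (d + 1)
    have h3 := ker_inf_dim ((g - 1) ^ (d + 1)) (b γ) ⟨z, hzd d, by simp [hz1]⟩
    rw [← hP] at h3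
    rw [h1] at h2
    omega
  refine ⟨⟨?_, ?_⟩, ?_⟩
  · have c1 := rank_convex XQ 0
    have c2 := rank_convex (g - 1) 0
    have e1 := r1 0
    have e2 := r1 1
    unfold jordanMult
    simp only [zero_add, Nat.reduceAdd] at *
    rw [show (1 - 1 : ℕ) = 0 from rfl]
    omega
  · intro d hd
    obtain ⟨d, rfl⟩ := Nat.exists_eq_add_of_le' hd
    unfold jordanMult
    rw [show d + (1 + 1) - 1 = d + 1 by omega, r1,
      show d + (1 + 1) + 1 = (d + 1 + 1) + 1 by omega, r1,
      show d + (1 + 1) = (d + 1) + 1 by omega, r1]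
  · intro d hd
    apply eps_congr
    rw [eps_quot (g - 1) b P γ Q π hπ hker hXP XQ hXQ bQ hbQ]
    obtain ⟨d, rfl⟩ := Nat.exists_eq_add_of_le' hd
    constructor
    · rintro ⟨x, hx, h1, h2⟩
      refine ⟨x, ?_, h2⟩
      have h3 : x ∈ P ⊓ (Submodule.span K {γ}).comap ((g - 1) ^ (d + 1)) := ⟨hx, h1⟩
      rw [comap_miss ((g - 1) ^ (d + 1)) P γ (fun y _ => miss d y)] at h3
      exact h3.2
    · rintro ⟨x, h1, h2⟩
      rcases d with _ | d
      · simp [halt] at h2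
      refine ⟨x - b γ x • z, by simp [hP, hz1], by simp [h1, hzd], ?_⟩
      rw [show d + 1 + 1 - 1 = d + 1 by omega] at h2 ⊢
      rw [map_sub ((g - 1) ^ (d + 1)), map_smul, hzd, smul_zero, sub_zero, map_sub, map_smul,
        hsymm _ z,
        form_vanish g b hinv (d + 1) z x (hzd d), smul_zero, sub_zero]
      exact h2

/-- `n` even, `α > 0`, with `q = 2 ^ α` and `b γ δ = n / q` -/
lemma abs_even_pos (g : A →ₗ[K] A) (b : A →ₗ[K] A →ₗ[K] K)
    (hinv : ∀ x y, b (g x) (g y) = b x y) (hsymm : ∀ x y, b x y = b y x)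
    (halt : ∀ x, b x x = 0) (γ : A) (hγ : g γ = γ)
    (q : ℕ) (hq : 2 ≤ q) (hq2 : 2 ∣ q)
    (δ : A) (hδ : ((g - 1) ^ (q - 1)) δ = γ)
    (z : A) (hz : ((g - 1) ^ q) z = 0) (hz1 : b γ z = 1)
    (w : A) (hw : ((g - 1) ^ q) w = 0) (hw0 : b γ w = 0) (hw1 : b (((g - 1) ^ (q - 1)) w) w ≠ 0)
    (hkerX : ∀ z, (g - 1) z = 0 → ∃ y, ((g - 1) ^ (q - 1)) y = z)
    (P : Submodule K A) (hP : P = ker (b γ)) (Q : Type*) [AddCommGroup Q] [Module K Q]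
    (π : P →ₗ[K] Q) (hπ : Function.Surjective π)
    (hker : ∀ x : P, π x = 0 ↔ (x : A) ∈ Submodule.span K {γ})
    (hXP : ∀ x ∈ P, (g - 1) x ∈ P) (XQ : Q →ₗ[K] Q)
    (hXQ : ∀ x : P, XQ (π x) = π ⟨(g - 1) x, hXP _ x.2⟩)
    (bQ : Q →ₗ[K] Q →ₗ[K] K) (hbQ : ∀ x y : P, bQ (π x) (π y) = b x y) :
    (b γ δ = 0 → (jordanMult K XQ q + 2 = jordanMult K (g - 1) q ∧ jordanMult K XQ (q - 1) = 2 ∧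
      ∀ d, 1 ≤ d → d ≠ q → d ≠ q - 1 → jordanMult K XQ d = jordanMult K (g - 1) d)) ∧
    (b γ δ ≠ 0 → (jordanMult K XQ q + 1 = jordanMult K (g - 1) q ∧
      (2 < q → jordanMult K XQ (q - 2) = 1) ∧
      ∀ d, 1 ≤ d → d ≠ q → d ≠ q - 2 → jordanMult K XQ d = jordanMult K (g - 1) d)) ∧
    (b γ δ ≠ 0 → 2 < q → eps K (g - 1) b (q - 2) = 0 ∧ eps K XQ bQ (q - 2) = 1) ∧
    (∀ d, 1 ≤ d → (b γ δ ≠ 0 → d ≠ q - 2) → eps K XQ bQ d = eps K (g - 1) b d) := by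
  have hγne : γ ≠ 0 := by rintro rfl; simp at hz1
  have : FiniteDimensional K Q := Module.Finite.of_surjective π hπ
  have hδq : ∀ d, q ≤ d → ((g - 1) ^ d) δ = 0 := by
    intro d hd
    apply pow_eq_zero_of_le' (g - 1) (show q - 1 + 1 ≤ d by omega)
    rw [pow_succ', Module.End.mul_apply, hδ]; simp [hγ]
  have hzd : ∀ d, q ≤ d → ((g - 1) ^ d) z = 0 := fun d hd => pow_eq_zero_of_le' _ hd _ hz
  have miss : ∀ d, q ≤ d → ∀ y, ((g - 1) ^ d) y ≠ γ := by
    intro d hd y h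
    have := form_vanish g b hinv d z y (hzd d hd)
    rw [h, hsymm, hz1] at this
    exact one_ne_zero this
  have inP : ∀ d, d < q → ∀ x, ((g - 1) ^ d) x = 0 → b γ x = 0 := by
    intro d hd x hx
    have := form_vanish g b hinv (q - 1) x δ (pow_eq_zero_of_le' _ (by omega) _ hx)
    rw [hδ] at this
    rw [hsymm, this]
  have bγX : ∀ x, ∀ k, 1 ≤ k → b γ (((g - 1) ^ k) x) = 0 := by
    intro x k hk
    obtain ⟨k, rfl⟩ := Nat.exists_eq_add_of_le' hk
    rw [pow_succ', Module.End.mul_apply, form_γ_X g b hinv γ hγ]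
  have hδd : ∀ d, d < q → ((g - 1) ^ d) (((g - 1) ^ (q - 1 - d)) δ) = γ := by
    intro d hd
    rw [← Module.End.mul_apply, ← pow_add, ← hδ]
    congr 2; omega
  have R := rank_quot (g - 1) P γ Q π hπ hker hXP XQ hXQ
  have N : ∀ d, finrank K (range ((g - 1) ^ d)) + finrank K (ker ((g - 1) ^ d)) = finrank K A :=
    fun d => LinearMap.finrank_range_add_finrank_ker _
  have hPA : finrank K P + 1 = finrank K A := by
    rw [hP]; exact ker_dim (b γ) ⟨z, by simp [hz1]⟩
  have rbig : ∀ d, q ≤ d → finrank K (range (XQ ^ d)) = finrank K (range ((g - 1) ^ d)) := by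
    intro d hd
    have h1 := comap_miss ((g - 1) ^ d) P γ (fun y _ => miss d hd y)
    have h2 := R d
    have := N d
    have h3 := ker_inf_dim ((g - 1) ^ d) (b γ) ⟨z, hzd d hd, by simp [hz1]⟩
    rw [← hP] at h3
    rw [h1] at h2
    omega
  have rhit : ∀ d, d < q → (d = q - 1 → b γ δ = 0) →
      finrank K (range (XQ ^ d)) + 2 = finrank K (range ((g - 1) ^ d)) := by
    intro d hd hd'
    have h1 := comap_dim_hit ((g - 1) ^ d) P γ hγne
      (by intro x hx; rw [hP]; exact inP d hd x hx)
      ⟨((g - 1) ^ (q - 1 - d)) δ, by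
        rw [hP, LinearMap.mem_ker]
        by_cases h : d = q - 1
        · subst h; simpa using hd' rfl
        · exact bγX _ _ (by omega), hδd d hd⟩
    have := R d
    have := N d
    omega
  have rmid : b γ δ ≠ 0 → 
      finrank K (range (XQ ^ (q - 1))) + 1 = finrank K (range ((g - 1) ^ (q - 1))) := by
    intro h0
    have h1 := comap_miss ((g - 1) ^ (q - 1)) P γ (by
      intro y hy h
      apply h0
      have h2 := inP (q - 1) (by omega) (δ - y) (by rw [map_sub, hδ, h, sub_self])
      rw [hP, LinearMap.mem_ker] at hy
      rwa [map_sub, hy, sub_zero] at h2)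
    have h2 := R (q - 1)
    have := N (q - 1)
    rw [h1, inf_eq_right.2 (by intro x hx; rw [hP]; exact inP (q - 1) (by omega) x hx)] at h2
    omega
  have L := fun d hd => rank_linear (g - 1) q hkerX d hd
  have C := rank_convex (g - 1)
  have C' := rank_convex XQ
  obtain ⟨q, rfl⟩ := Nat.exists_eq_add_of_le' hq
  have epsA : ∀ d, 1 ≤ d → d < q + 2 → ∀ x, ((g - 1) ^ d) x = 0 →
      b (((g - 1) ^ (d - 1)) x) x = 0 := by
    intro d hd hdq x hx
    have h1 : (g - 1) (((g - 1) ^ (d - 1)) x) = 0 := by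
      rw [← Module.End.mul_apply, ← pow_succ', show d - 1 + 1 = d by omega, hx]
    obtain ⟨y, hy⟩ := hkerX _ h1
    rw [← hy, hsymm]
    exact form_vanish g b hinv _ _ _ (pow_eq_zero_of_le' _ (by omega) _ hx)
  -- value of the form in the subquotient for small `d`
  have epsQ : ∀ d, 1 ≤ d → d ≤ q → ∀ x, ∀ c : K, ((g - 1) ^ d) x = c • γ →
      b (((g - 1) ^ (d - 1)) x) x = if d = q then c * (c * b γ δ) else 0 := by
    intro d hd hdq x c hx
    set v := ((g - 1) ^ (q + 2 - 1 - d)) δ with hv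
    have hx' : ((g - 1) ^ d) (x - c • v) = 0 := by
      rw [map_sub, map_smul, hv, hδd d (by omega), hx, sub_self]
    obtain ⟨y, hy⟩ : ∃ y, y = x - c • v := ⟨_, rfl⟩
    rw [← hy] at hx'
    have hxy : x = y + c • v := by rw [hy]; simp
    have t1 := epsA d hd (by omega) y hx'
    have t2 : b (((g - 1) ^ (d - 1)) v) y = 0 := by
      rw [hv, ← Module.End.mul_apply, ← pow_add, hsymm]
      exact form_vanish g b hinv _ _ _ (pow_eq_zero_of_le' _ (by omega) _ hx')
    have t3 : b (((g - 1) ^ (d - 1)) y) v = 0 := by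
      rw [hv, form_shift g b hinv, pow_eq_zero_of_le' (g - 1) (show d ≤ _ by omega) y hx']
      simp
    have t4 : b (((g - 1) ^ (d - 1)) v) v = if d = q then b γ δ else 0 := by
      rw [hv, ← Module.End.mul_apply, ← pow_add, form_shift g b hinv]
      split_ifs with h
      · subst h
        rw [show d - 1 + (d + 2 - 1 - d) + (d + 2 - 1 - d) = d + 2 - 1 by omega, hδ,
          form_g_pow g b hinv γ hγ]
      · rw [hδq _ (by omega)]; simp
    rw [hxy]
    simp only [map_add, map_smul, LinearMap.add_apply, LinearMap.smul_apply, t1, t2, t3, t4,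
      smul_eq_mul]
    split_ifs <;> ring
  refine ⟨?_, ?_, ?_, ?_⟩
  · intro h0
    have J : ∀ d, d < q + 2 → 
        finrank K (range (XQ ^ d)) + 2 = finrank K (range ((g - 1) ^ d)) :=
      fun d hd => rhit d hd (fun _ => h0)
    refine ⟨?_, ?_, ?_⟩
    · have := J (q + 1) (by omega)
      have := rbig (q + 2) (by omega)
      have := rbig (q + 3) (by omega)
      have c1 := C (q + 1)
      have c2 := C' (q + 1)
      rw [show q + 1 + 1 = q + 2 from rfl, show q + 1 + 2 = q + 3 from rfl] at c1 c2
      unfold jordanMult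
      rw [show q + 2 - 1 = q + 1 by omega, show q + 2 + 1 = q + 3 by omega]
      omega
    · have := J q (by omega)
      have := J (q + 1) (by omega)
      have := rbig (q + 2) (by omega)
      have := L q (by omega)
      unfold jordanMult
      rw [show q + 2 - 1 - 1 = q by omega, show q + 2 - 1 + 1 = q + 2 by omega,
        show q + 2 - 1 = q + 1 by omega]
      omega
    · intro d hd hd1 hd2
      obtain ⟨d, rfl⟩ := Nat.exists_eq_add_of_le' hd
      have c1 := C d
      have c2 := C' d
      unfold jordanMult
      rw [show d + 1 - 1 = d by omega, show d + 1 + 1 = d + 2 by omega]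
      by_cases h : d < q
      · have := J d (by omega)
        have := J (d + 1) (by omega)
        have := J (d + 2) (by omega)
        omega
      · rw [rbig d (by omega), rbig (d + 1) (by omega), rbig (d + 2) (by omega)]
  · intro h0
    have J : ∀ d, d < q + 1 → 
        finrank K (range (XQ ^ d)) + 2 = finrank K (range ((g - 1) ^ d)) :=
      fun d hd => rhit d (by omega) (fun h => by omega)
    have M := rmid h0
    rw [show q + 2 - 1 = q + 1 by omega] at M
    refine ⟨?_, ?_, ?_⟩
    · have := rbig (q + 2) (by omega)
      have := rbig (q + 3) (by omega)
      have c1 := C (q + 1)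
      have c2 := C' (q + 1)
      rw [show q + 1 + 1 = q + 2 from rfl, show q + 1 + 2 = q + 3 from rfl] at c1 c2
      unfold jordanMult
      rw [show q + 2 - 1 = q + 1 by omega, show q + 2 + 1 = q + 3 by omega]
      omega
    · intro hq0
      obtain ⟨r, rfl⟩ := Nat.exists_eq_add_of_le' (show 1 ≤ q by omega)
      have := J (r + 1) (by omega)
      have := J r (by omega)
      have := L r (by omega)
      unfold jordanMult
      rw [show r + 1 + 2 - 2 - 1 = r by omega, show r + 1 + 2 - 2 + 1 = r + 2 by omega,
        show r + 1 + 2 - 2 = r + 1 by omega]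
      rw [show r + 1 + 1 = r + 2 by omega] at M
      omega
    · intro d hd hd1 hd2
      obtain ⟨d, rfl⟩ := Nat.exists_eq_add_of_le' hd
      have c1 := C d
      have c2 := C' d
      unfold jordanMult
      rw [show d + 1 - 1 = d by omega, show d + 1 + 1 = d + 2 by omega]
      by_cases h : d + 1 < q
      · have := J d (by omega)
        have := J (d + 1) (by omega)
        have := J (d + 2) (by omega)
        omega
      · by_cases h' : d = q
        · subst h'
          have := J d (by omega)
          have := rbig (d + 2) (by omega)
          omega
        · rw [rbig d (by omega), rbig (d + 1) (by omega), rbig (d + 2) (by omega)]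
  · intro h0 hq0
    rw [show q + 2 - 2 = q by omega]
    refine ⟨eps_zero _ _ _ ?_, eps_one _ _ _ ?_⟩
    · rintro ⟨x, h1, h2⟩
      exact h2 (epsA q (by omega) (by omega) x h1)
    · rw [eps_quot (g - 1) b P γ Q π hπ hker hXP XQ hXQ bQ hbQ]
      have e := hδd q (by omega)
      refine ⟨((g - 1) ^ (q + 2 - 1 - q)) δ, ?_, ?_, ?_⟩
      · rw [hP]; exact bγX _ _ (by omega)
      · rw [e]; exact Submodule.mem_span_singleton_self γ
      · rw [epsQ q (by omega) le_rfl _ 1 (by rw [e, one_smul]), if_pos rfl]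
        simpa using h0
  · intro d hd hd'
    apply eps_congr
    rw [eps_quot (g - 1) b P γ Q π hπ hker hXP XQ hXQ bQ hbQ]
    constructor
    · rintro ⟨x, hx, h1, h2⟩
      by_cases hdq : q + 2 ≤ d
      · refine ⟨x, ?_, h2⟩
        have h3 : x ∈ P ⊓ (Submodule.span K {γ}).comap ((g - 1) ^ d) := ⟨hx, h1⟩
        rw [comap_miss ((g - 1) ^ d) P γ (fun y _ => miss d hdq y)] at h3
        exact h3.2
      · exfalso
        by_cases hd3 : d ≤ q
        · obtain ⟨c, hc⟩ := Submodule.mem_span_singleton.1 h1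
          apply h2
          rw [epsQ d hd hd3 x c hc.symm]
          split_ifs with h
          · by_cases h0 : b γ δ = 0
            · rw [h0]; simp
            · exact absurd h (by have := hd' h0; omega)
          · rfl
        · obtain ⟨m, rfl⟩ : ∃ m, d = 2 * m + 1 := ⟨q / 2, by omega⟩
          rw [hP, LinearMap.mem_ker] at hx
          exact h2 (form_odd g b hinv hsymm halt γ hγ m x h1 hx)
    · rintro ⟨x, h1, h2⟩
      by_cases hdq : q + 2 < d
      · refine ⟨x - b γ x • z, by simp [hP, hz1], by simp [h1, hzd d (by omega)], ?_⟩
        have ez := hzd (d - 1) (by omega)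
        rw [map_sub ((g - 1) ^ (d - 1)), map_smul, ez, smul_zero, sub_zero, map_sub, map_smul,
          hsymm _ z,
          form_vanish g b hinv (d - 1) z x (hzd _ (by omega)), smul_zero, sub_zero]
        exact h2
      · by_cases hdq' : d = q + 2
        · subst hdq'
          exact ⟨w, by simp [hP, hw0], by simp [hw], hw1⟩
        · exact absurd (epsA d hd (by omega) x h1) h2

end Main

section Jordan

lemma dfinsupp_basis_apply {ι R : Type*} {M : ι → Type*} [Semiring R] [∀ i, AddCommMonoid (M i)]
    [∀ i, Module R (M i)] [DecidableEq ι] {η : ι → Type*} (b : ∀ i, Basis (η i) R (M i)) (i : ι) (j : η i) :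
    DFinsupp.basis b ⟨i, j⟩ = DFinsupp.single i (b i j) := by
  classical
  rw [Basis.apply_eq_iff]
  unfold DFinsupp.basis
  change (sigmaFinsuppLequivDFinsupp R).symm (DFinsupp.mapRange.linearEquiv (fun i => (b i).repr) (DFinsupp.single i (b i j))) = _
  rw [LinearEquiv.symm_apply_eq]
  change DFinsupp.mapRange (fun i x => (b i).repr x) (fun i => map_zero _)
    (DFinsupp.single i (b i j)) = _
  simp [sigmaFinsuppLequivDFinsupp]

open Polynomial in
lemma exists_jordan_basis {K : Type*} [Field K] {V : Type*} [AddCommGroup V] [Module K V]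
    [FiniteDimensional K V] (T : V →ₗ[K] V) (N : ℕ) (hT : T ^ N = 0) :
    ∃ (t : ℕ) (k : Fin t → ℕ) (v : Fin t → V) (e : Basis (Σ j : Fin t, Fin (k j)) K V),
      (∀ j i, e ⟨j, i⟩ = (T ^ (i : ℕ)) (v j)) ∧ ∀ j, (T ^ (k j)) (v j) = 0 := by
  classical
  have hpow : ∀ (m : ℕ) (x : AEval' T), (X ^ m : K[X]) • x = AEval'.of T ((T ^ m) ((AEval'.of T).symm x)) := by
    intro m x
    obtain ⟨x, rfl⟩ := (AEval'.of T).surjective x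
    rw [AEval'.X_pow_smul_of]
    simp
  have hM : Module.IsTorsion' (AEval' T) (Submonoid.powers (X : K[X])) := by
    intro x
    refine ⟨⟨X ^ N, N, rfl⟩, ?_⟩
    change (X ^ N : K[X]) • x = 0
    rw [hpow, hT]; simp
  have hfin : Module.Finite K[X] (AEval' T) := inferInstance
  obtain ⟨t, k, ⟨E⟩⟩ := Module.torsion_by_prime_power_decomposition (Polynomial.irreducible_X) hM
  let B : ∀ j, Basis (Fin (k j)) K (K[X] ⧸ Submodule.span K[X] {(X : K[X]) ^ k j}) := fun j =>
    ((AdjoinRoot.powerBasis' (monic_X_pow (R := K) (k j))).basis.reindex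
      (finCongr (by simp)))
  have hB : ∀ j i, B j i = (X ^ (i : ℕ) : K[X]) • (Submodule.Quotient.mk 1 : K[X] ⧸ Submodule.span K[X] {(X : K[X]) ^ k j}) := by
    intro j i
    have h1 : B j i = (AdjoinRoot.powerBasis' (monic_X_pow (R := K) (k j))).gen ^ (i : ℕ) := by
      change ((AdjoinRoot.powerBasis' (monic_X_pow (R := K) (k j))).basis.reindex
        (finCongr (by simp))) i = _
      rw [Basis.reindex_apply, PowerBasis.basis_eq_pow]
      rfl
    rw [h1, ← Submodule.Quotient.mk_smul, AdjoinRoot.powerBasis'_gen, ← AdjoinRoot.mk_X, ← map_pow,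
      smul_eq_mul, mul_one]
    rfl
  let D := DFinsupp.basis B
  let v : Fin t → V := fun j => (AEval'.of T).symm (E.symm (DirectSum.of _ j (Submodule.Quotient.mk 1)))
  refine ⟨t, k, v, (D.map (E.symm.restrictScalars K)).map (AEval'.of T).symm, ?_, ?_⟩
  · intro j i
    have h1 : ((D.map (E.symm.restrictScalars K)).map (AEval'.of T).symm) ⟨j, i⟩ =
        (AEval'.of T).symm (E.symm (DirectSum.of
          (fun j => K[X] ⧸ Submodule.span K[X] {(X : K[X]) ^ k j}) j (B j i))) := by
      rw [Basis.map_apply, Basis.map_apply]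
      change (AEval'.of T).symm (E.symm (D ⟨j, i⟩)) = _
      simp only [D]
      rw [dfinsupp_basis_apply]
      rfl
    rw [h1, hB, ← DirectSum.lof_eq_of K[X], map_smul, map_smul, hpow, LinearEquiv.symm_apply_apply]
    rfl
  · intro j
    have h1 := hpow (k j) (E.symm (DirectSum.of
          (fun j => K[X] ⧸ Submodule.span K[X] {(X : K[X]) ^ k j}) j (Submodule.Quotient.mk 1)))
    have h2 : (X ^ k j : K[X]) • (Submodule.Quotient.mk 1 :
        K[X] ⧸ Submodule.span K[X] {(X : K[X]) ^ k j}) = 0 := by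
      rw [← Submodule.Quotient.mk_smul, Submodule.Quotient.mk_eq_zero, smul_eq_mul, mul_one]
      exact Submodule.mem_span_singleton_self _
    rw [← DirectSum.lof_eq_of K[X], ← map_smul, ← map_smul, h2, map_zero, map_zero] at h1
    exact ((AEval'.of T).map_eq_zero_iff.1 h1.symm)

end Jordan

section Rank

variable {K : Type*} [Field K] {V : Type*} [AddCommGroup V] [Module K V]

lemma card_shift (t : ℕ) (k : Fin t → ℕ) (d : ℕ) :
    Fintype.card {s : Σ j : Fin t, Fin (k j) // d ≤ (s.2 : ℕ)} = ∑ j, (k j - d) := by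
  classical
  have e : {s : Σ j : Fin t, Fin (k j) // d ≤ (s.2 : ℕ)} ≃ Σ j : Fin t, Fin (k j - d) :=
    { toFun := fun s => ⟨s.1.1, ⟨s.1.2 - d, by have := s.2; have := s.1.2.2; omega⟩⟩
      invFun := fun s => ⟨⟨s.1, ⟨s.2 + d, by have := s.2.2; omega⟩⟩, by simp⟩
      left_inv := by
        rintro ⟨⟨j, i⟩, h⟩
        simp only at h
        simp only [Nat.sub_add_cancel h]
      right_inv := by
        rintro ⟨j, i⟩
        simp }
  rw [Fintype.card_congr e, Fintype.card_sigma]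
  simp

lemma rank_jordan (T : V →ₗ[K] V) (t : ℕ) (k : Fin t → ℕ) (v : Fin t → V)
    (e : Basis (Σ j : Fin t, Fin (k j)) K V) (he : ∀ j i, e ⟨j, i⟩ = (T ^ (i : ℕ)) (v j))
    (hv : ∀ j, (T ^ (k j)) (v j) = 0) (d : ℕ) :
    finrank K (range (T ^ d)) = ∑ j, (k j - d) := by
  classical
  rw [← card_shift t k d]
  have hli : LinearIndependent K (fun s : {s : Σ j : Fin t, Fin (k j) // d ≤ (s.2 : ℕ)} => e s) :=
    e.linearIndependent.comp _ Subtype.val_injective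
  rw [← finrank_span_eq_card hli]
  suffices hspan : range (T ^ d) = Submodule.span K (Set.range
      fun s : {s : Σ j : Fin t, Fin (k j) // d ≤ (s.2 : ℕ)} => e s) by rw [hspan]
  apply le_antisymm
  · rw [LinearMap.range_eq_map, ← e.span_eq, Submodule.map_span, Submodule.span_le]
    rintro _ ⟨_, ⟨⟨j, i⟩, rfl⟩, rfl⟩
    rw [he, ← Module.End.mul_apply, ← pow_add]
    by_cases h : d + (i : ℕ) < k j
    · apply Submodule.subset_span
      exact ⟨⟨⟨j, ⟨d + i, h⟩⟩, by simp⟩, by simp [he]⟩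
    · have : (T ^ (d + (i : ℕ))) (v j) = 0 := by
        obtain ⟨m, hm⟩ := Nat.exists_eq_add_of_le' (not_lt.1 h)
        rw [hm, pow_add, Module.End.mul_apply, hv, map_zero]
      rw [this]; exact Submodule.zero_mem _
  · rw [Submodule.span_le]
    rintro _ ⟨⟨⟨j, i⟩, h⟩, rfl⟩
    simp only at h
    refine ⟨(T ^ ((i : ℕ) - d)) (v j), ?_⟩
    change _ = e ⟨j, i⟩
    rw [← Module.End.mul_apply, ← pow_add, he]
    congr 2; omega

lemma jordanMult_ne_zero_iff (T : V →ₗ[K] V) (t : ℕ) (k : Fin t → ℕ) (v : Fin t → V)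
    (e : Basis (Σ j : Fin t, Fin (k j)) K V) (he : ∀ j i, e ⟨j, i⟩ = (T ^ (i : ℕ)) (v j))
    (hv : ∀ j, (T ^ (k j)) (v j) = 0) (m : ℕ) (hm : 1 ≤ m) :
    jordanMult K T m ≠ 0 ↔ ∃ j, k j = m := by
  classical
  unfold jordanMult
  simp only [rank_jordan T t k v e he hv]
  have h : ∑ j, (k j - (m - 1)) + ∑ j, (k j - (m + 1)) =
      2 * ∑ j, (k j - m) + ∑ j, if k j = m then 1 else 0 := by
    rw [Finset.mul_sum, ← Finset.sum_add_distrib, ← Finset.sum_add_distrib]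
    apply Finset.sum_congr rfl
    intro j _
    split_ifs <;> omega
  rw [h, Nat.add_sub_cancel_left]
  simp

end Rank

section Struct

variable {K : Type*} [Field K] {V : Type*} [AddCommGroup V] [Module K V] [FiniteDimensional K V]

lemma trace_sum_repr {W : Type*} [AddCommGroup W] [Module K W] {I : Type*} [Fintype I]
    (fB : Basis I K W) (f : W →ₗ[K] W) : LinearMap.trace K W f = ∑ i, fB.repr (f (fB i)) i := by
  classical
  rw [LinearMap.trace_eq_matrix_trace K fB, Matrix.trace]
  simp [LinearMap.toMatrix_apply]

lemma basis_ext_apply {W M : Type*} [AddCommGroup W] [Module K W] [AddCommGroup M] [Module K M]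
    {I : Type*} (B : Basis I K W) (f g : W →ₗ[K] M) (h : ∀ i, f (B i) = g (B i)) (x : W) :
    f x = g x := by
  have : f = g := B.ext h
  rw [this]

lemma exists_struct (T : V →ₗ[K] V) (N : ℕ) (hT : T ^ N = 0) (α : ℕ)
    (hα1 : ∀ m : ℕ, 1 ≤ m → jordanMult K T m ≠ 0 → 2 ^ α ∣ m)
    (hα2 : ∃ m : ℕ, 1 ≤ m ∧ jordanMult K T m ≠ 0 ∧ ¬ 2 ^ (α + 1) ∣ m) :
    ∃ (I : Type) (_ : Fintype I) (ι : (I → K) →ₗ[K] V) (p : V →ₗ[K] (I → K))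
      (Y pr : (I → K) →ₗ[K] (I → K)) (r : ℕ),
      (∀ x, (T ^ (2 ^ α)) (ι x) = ι (Y x)) ∧ (∀ x, p ((T ^ (2 ^ α)) x) = Y (p x)) ∧
      (∀ i, i < 2 ^ α - 1 → ∀ x, p ((T ^ i) (ι x)) = 0) ∧
      (∀ x, p ((T ^ (2 ^ α - 1)) (ι x)) = x) ∧
      (∀ D : V →ₗ[K] V, (∀ x, D (T x) = T (D x)) → (∀ x, D (ι x) = ι x) → ∀ x, D x = x) ∧
      Fintype.card I * 2 ^ α = finrank K V ∧
      (∀ x, pr (Y x) = Y (pr x)) ∧ (∀ x, pr (pr x) = pr x) ∧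
      LinearMap.trace K (I → K) pr = (r : K) ∧ ¬ 2 ∣ r := by
  classical
  obtain ⟨t, k, v, e, he, hv⟩ := exists_jordan_basis T N hT
  have hJ := jordanMult_ne_zero_iff T t k v e he hv
  set q := 2 ^ α with hq
  have hq0 : 0 < q := by positivity
  have hk : ∀ j, ∃ l, k j = q * l := by
    intro j
    rcases Nat.eq_zero_or_pos (k j) with h | h
    · exact ⟨0, by simp [h]⟩
    · exact hα1 _ h ((hJ _ h).2 ⟨j, rfl⟩)
  choose l hl using hk
  obtain ⟨j0, hj0⟩ : ∃ j0, ¬ 2 ∣ l j0 := by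
    obtain ⟨m, hm, h1, h2⟩ := hα2
    obtain ⟨j, rfl⟩ := (hJ m hm).1 h1
    refine ⟨j, fun h => h2 ?_⟩
    rw [hl, pow_succ]
    exact Nat.mul_dvd_mul_left q h
  have hv' : ∀ j i, k j ≤ i → (T ^ i) (v j) = 0 := by
    intro j i h
    obtain ⟨m, rfl⟩ := Nat.exists_eq_add_of_le' h
    rw [pow_add, Module.End.mul_apply, hv, map_zero]
  let I := Σ j : Fin t, Fin (l j)
  let fB : Basis I K (I → K) := Pi.basisFun K I
  let F : Fin t → ℕ → (I → K) := fun j m => if h : m < l j then fB ⟨j, ⟨m, h⟩⟩ else 0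
  have hF : ∀ s : I, F s.1 s.2 = fB s := by
    rintro ⟨j, i⟩
    simp [F]
  have hF0 : ∀ j m, l j ≤ m → F j m = 0 := by
    intro j m h
    simp [F, not_lt.2 h]
  let Y : (I → K) →ₗ[K] (I → K) := fB.constr K (fun s => F s.1 (s.2 + 1))
  let ι : (I → K) →ₗ[K] V := fB.constr K (fun s => (T ^ (q * s.2)) (v s.1))
  let p : V →ₗ[K] (I → K) :=
    e.constr K (fun s => if (s.2 : ℕ) % q = q - 1 then F s.1 (s.2 / q) else 0)
  let pr : (I → K) →ₗ[K] (I → K) := fB.constr K (fun s => if s.1 = j0 then fB s else 0)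
  have hY : ∀ j m, Y (F j m) = F j (m + 1) := by
    intro j m
    by_cases h : m < l j
    · have := hF ⟨j, ⟨m, h⟩⟩
      simp only at this
      rw [this]
      exact fB.constr_basis K _ _
    · rw [hF0 _ _ (by omega), hF0 _ _ (by omega), map_zero]
  have hι : ∀ j m, ι (F j m) = (T ^ (q * m)) (v j) := by
    intro j m
    by_cases h : m < l j
    · have := hF ⟨j, ⟨m, h⟩⟩
      simp only at this
      rw [this]
      exact fB.constr_basis K _ _
    · rw [hF0 _ _ (by omega), map_zero, hv' _ _ (by rw [hl]; exact Nat.mul_le_mul_left q (by omega))]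
  have hpr : ∀ j m, pr (F j m) = if j = j0 then F j m else 0 := by
    intro j m
    by_cases h : m < l j
    · have := hF ⟨j, ⟨m, h⟩⟩
      simp only at this
      rw [this]
      exact fB.constr_basis K _ _
    · rw [hF0 _ _ (by omega), map_zero, ite_self]
  have hp : ∀ j i, p ((T ^ i) (v j)) = if i % q = q - 1 then F j (i / q) else 0 := by
    intro j i
    by_cases h : i < k j
    · have := he j ⟨i, h⟩
      simp only at this
      rw [← this]
      exact e.constr_basis K _ _
    · rw [hv' _ _ (by omega), map_zero, hF0, ite_self]
      rw [Nat.le_div_iff_mul_le hq0, mul_comm, ← hl]; omega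
  have extF1 : ∀ (f g : (I → K) →ₗ[K] V),
      (∀ j m, f (F j m) = g (F j m)) → ∀ x, f x = g x :=
    fun f g h x => basis_ext_apply fB f g (fun s => by rw [← hF]; exact h _ _) x
  have extF2 : ∀ (f g : (I → K) →ₗ[K] (I → K)),
      (∀ j m, f (F j m) = g (F j m)) → ∀ x, f x = g x :=
    fun f g h x => basis_ext_apply fB f g (fun s => by rw [← hF]; exact h _ _) x
  have extV1 : ∀ (f g : V →ₗ[K] V),
      (∀ j i, f ((T ^ i) (v j)) = g ((T ^ i) (v j))) → ∀ x, f x = g x :=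
    fun f g h x => basis_ext_apply e f g (fun ⟨j, i⟩ => by rw [he]; exact h _ _) x
  have extV2 : ∀ (f g : V →ₗ[K] (I → K)),
      (∀ j i, f ((T ^ i) (v j)) = g ((T ^ i) (v j))) → ∀ x, f x = g x :=
    fun f g h x => basis_ext_apply e f g (fun ⟨j, i⟩ => by rw [he]; exact h _ _) x
  refine ⟨I, inferInstance, ι, p, Y, pr, l j0, ?_, ?_, ?_, ?_, ?_, ?_, ?_, ?_, ?_, hj0⟩
  · refine extF1 ((T ^ q) ∘ₗ ι) (ι ∘ₗ Y) ?_
    intro j m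
    simp only [LinearMap.comp_apply, hY, hι]
    rw [← Module.End.mul_apply, ← pow_add]
    congr 2; ring
  · refine extV2 (p ∘ₗ (T ^ q)) (Y ∘ₗ p) ?_
    intro j i
    simp only [LinearMap.comp_apply]
    rw [← Module.End.mul_apply, ← pow_add, hp, hp, Nat.add_mod_left, apply_ite Y, hY, map_zero,
      Nat.add_div_left _ hq0]
  · intro i hi
    refine extF2 (p ∘ₗ (T ^ i) ∘ₗ ι) 0 ?_
    intro j m
    simp only [LinearMap.comp_apply, hι, LinearMap.zero_apply]
    rw [← Module.End.mul_apply, ← pow_add, hp, if_neg]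
    rw [Nat.add_mul_mod_self_left, Nat.mod_eq_of_lt (by omega)]
    omega
  · refine extF2 (p ∘ₗ (T ^ (q - 1)) ∘ₗ ι) LinearMap.id ?_
    intro j m
    simp only [LinearMap.comp_apply, hι, LinearMap.id_apply]
    rw [← Module.End.mul_apply, ← pow_add, hp, if_pos]
    · rw [Nat.add_mul_div_left _ _ hq0, Nat.div_eq_of_lt (by omega), zero_add]
    · rw [Nat.add_mul_mod_self_left, Nat.mod_eq_of_lt (by omega)]
  · intro D hD hDι
    have hDT : ∀ i x, D ((T ^ i) x) = (T ^ i) (D x) := by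
      intro i
      induction i with
      | zero => simp
      | succ i ih => intro x; rw [pow_succ', Module.End.mul_apply, hD, ih, Module.End.mul_apply]
    refine extV1 D LinearMap.id ?_
    intro j i
    have : (T ^ i) (v j) = (T ^ (i % q)) (ι (F j (i / q))) := by
      rw [hι, ← Module.End.mul_apply, ← pow_add, Nat.mod_add_div]
    rw [this, hDT, hDι, LinearMap.id_apply]
  · rw [finrank_eq_card_basis e]
    simp only [Fintype.card_sigma, Fintype.card_fin, I, hl, Finset.sum_mul, mul_comm]
  · refine extF2 (pr ∘ₗ Y) (Y ∘ₗ pr) ?_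
    intro j m
    simp only [LinearMap.comp_apply, hY, hpr]
    rw [apply_ite Y, hY, map_zero]
  · refine extF2 (pr ∘ₗ pr) pr ?_
    intro j m
    simp only [LinearMap.comp_apply, hpr]
    split_ifs with h
    · rw [hpr, if_pos h]
    · simp
  · rw [trace_sum_repr fB]
    have : ∀ s : I, fB.repr (pr (fB s)) s = if s.1 = j0 then 1 else 0 := by
      intro s
      rw [← hF, hpr, hF]
      split_ifs <;> simp
    simp only [this]
    rw [Fintype.sum_sigma, Finset.sum_eq_single j0]
    · simp
    · intro j _ hj
      simp [hj]
    · simp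

end Struct

section Elements

open Polynomial in
lemma poly_char_two (K : Type*) [Field K] [CharP K 2] (α : ℕ) :
    ((X : K[X]) - 1) ^ (2 ^ α) = X ^ (2 ^ α) - 1 ∧
    ((X : K[X]) - 1) ^ (2 ^ α - 1) = ∑ i ∈ Finset.range (2 ^ α), X ^ i := by
  have h1 : ((X : K[X]) - 1) ^ (2 ^ α) = X ^ (2 ^ α) - 1 := by
    have := sub_pow_char_pow (p := 2) (n := α) (X : K[X]) 1
    rwa [one_pow] at this
  refine ⟨h1, ?_⟩
  have h2 : (X : K[X]) - 1 ≠ 0 := by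
    have := Polynomial.X_sub_C_ne_zero (1 : K)
    rwa [C_1] at this
  apply mul_right_cancel₀ h2
  rw [geom_sum_mul, ← pow_succ, Nat.sub_add_cancel Nat.one_le_two_pow, h1]

lemma alg_char_two {K : Type*} [Field K] [CharP K 2] {A : Type*} [AddCommGroup A] [Module K A]
    (g : A →ₗ[K] A) (α : ℕ) :
    (g - 1) ^ (2 ^ α) = g ^ (2 ^ α) - 1 ∧
    (g - 1) ^ (2 ^ α - 1) = ∑ i ∈ Finset.range (2 ^ α), g ^ i := by
  obtain ⟨h1, h2⟩ := poly_char_two K α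
  have h1' := congrArg (Polynomial.aeval (R := K) (A := Module.End K A) g) h1
  have h2' := congrArg (Polynomial.aeval (R := K) (A := Module.End K A) g) h2
  simp only [map_pow, map_sub, map_one, map_sum, Polynomial.aeval_X] at h1' h2'
  exact ⟨h1', h2'⟩

variable {K : Type*} [Field K] {V : Type*} [AddCommGroup V] [Module K V]

/-- The norm-like sum of conjugates. -/
def nrm (U Ui : V →ₗ[K] V) (q : ℕ) (x : V →ₗ[K] V) : V →ₗ[K] V :=
  ∑ i ∈ Finset.range q, U ^ i * x * Ui ^ i

lemma inv_pow_mul (U Ui : V →ₗ[K] V) (h1 : U * Ui = 1) (m : ℕ) : U ^ m * Ui ^ m = 1 := by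
  induction m with
  | zero => simp
  | succ m ih => rw [pow_succ, pow_succ', mul_assoc, ← mul_assoc U, h1, one_mul, ih]

lemma pow_mul_inv (U Ui : V →ₗ[K] V) (h1 : U * Ui = 1) (m i : ℕ) (h : i ≤ m) :
    U ^ m * Ui ^ i = U ^ (m - i) := by
  obtain ⟨k, rfl⟩ := Nat.exists_eq_add_of_le' h
  rw [pow_add, mul_assoc, inv_pow_mul U Ui h1, mul_one, Nat.add_sub_cancel]

lemma nrm_comm (U Ui : V →ₗ[K] V) (h1 : U * Ui = 1) (h2 : Ui * U = 1) (q : ℕ) (x : V →ₗ[K] V)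
    (hx : U ^ q * x = x * U ^ q) : nrm U Ui q x * U = U * nrm U Ui q x := by
  have h3 : U * nrm U Ui q x * Ui = nrm U Ui q x := by
    unfold nrm
    have h4 : ∀ i, U * (U ^ i * x * Ui ^ i) * Ui = U ^ (i + 1) * x * Ui ^ (i + 1) := by
      intro i
      rw [pow_succ', pow_succ]; simp only [mul_assoc]
    have h5 := Finset.sum_range_succ (fun i => U ^ i * x * Ui ^ i) q
    rw [Finset.sum_range_succ', hx, mul_assoc x, inv_pow_mul U Ui h1, mul_one] at h5
    simp only [pow_zero, one_mul, mul_one] at h5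
    rw [Finset.mul_sum, Finset.sum_mul, Finset.sum_congr rfl (fun i _ => h4 i)]
    exact add_right_cancel h5
  calc nrm U Ui q x * U = U * nrm U Ui q x * Ui * U := by rw [h3]
    _ = U * nrm U Ui q x := by rw [mul_assoc, h2, mul_one]

lemma pUι {W : Type*} [AddCommGroup W] [Module K W] (U : V →ₗ[K] V) (q : ℕ)
    (ι : W →ₗ[K] V) (p : V →ₗ[K] W)
    (h0 : ∀ i, i < q - 1 → ∀ x, p (((U - 1) ^ i) (ι x)) = 0)
    (h1 : ∀ x, p (((U - 1) ^ (q - 1)) (ι x)) = x) (m : ℕ) :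
    (∀ i, m + i < q - 1 → ∀ x, p (((U - 1) ^ i) ((U ^ m) (ι x))) = 0) ∧
    (∀ i, m + i = q - 1 → ∀ x, p (((U - 1) ^ i) ((U ^ m) (ι x))) = x) := by
  induction m with
  | zero =>
    refine ⟨fun i hi x => ?_, fun i hi x => ?_⟩
    · simpa using h0 i (by omega) x
    · have : i = q - 1 := by omega
      subst this
      simpa using h1 x
  | succ m ih =>
    have key : ∀ (i : ℕ) (x : W), ((U - 1) ^ i) ((U ^ (m + 1)) (ι x)) =
        ((U - 1) ^ (i + 1)) ((U ^ m) (ι x)) + ((U - 1) ^ i) ((U ^ m) (ι x)) := by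
      intro i x
      rw [pow_succ' U, pow_succ (U - 1), Module.End.mul_apply, Module.End.mul_apply, ← map_add]
      congr 1
      simp
    refine ⟨fun i hi x => ?_, fun i hi x => ?_⟩
    · rw [key, map_add, ih.1 _ (by omega), ih.1 _ (by omega), add_zero]
    · rw [key, map_add, ih.2 _ (by omega), ih.1 _ (by omega), add_zero]

variable [CharP K 2] [FiniteDimensional K V]

lemma exists_elems (U Ui : V →ₗ[K] V) (hU1 : U * Ui = 1) (hU2 : Ui * U = 1)
    (N : ℕ) (hT : (U - 1) ^ N = 0) (α : ℕ)
    (hα1 : ∀ m : ℕ, 1 ≤ m → jordanMult K (U - 1) m ≠ 0 → 2 ^ α ∣ m)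
    (hα2 : ∃ m : ℕ, 1 ≤ m ∧ jordanMult K (U - 1) m ≠ 0 ∧ ¬ 2 ^ (α + 1) ∣ m) :
    ∃ δ z w : V →ₗ[K] V,
      nrm U Ui (2 ^ α) δ = 1 ∧ LinearMap.trace K V δ = ((finrank K V / 2 ^ α : ℕ) : K) ∧
      U ^ (2 ^ α) * z = z * U ^ (2 ^ α) ∧ LinearMap.trace K V z = 1 ∧
      (1 ≤ α → U ^ (2 ^ α) * w = w * U ^ (2 ^ α) ∧ LinearMap.trace K V w = 0 ∧
        LinearMap.trace K V (nrm U Ui (2 ^ α) w * w) = 1) := by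
  obtain ⟨I, _, ι, p, Y, pr, r, hι, hp, h0, h1, hD, hcard, hprY, hpr2, hr, hr2⟩ :=
    exists_struct (U - 1) N hT α hα1 hα2
  have hr1 : (r : K) = 1 := by
    obtain ⟨s, hs⟩ : ∃ s, r = 2 * s + 1 := ⟨r / 2, by omega⟩
    rw [hs]; push_cast
    have : (2 : K) = 0 := CharTwo.two_eq_zero
    rw [this]; simp
  have hq0 : 0 < 2 ^ α := by positivity
  obtain ⟨hUq, -⟩ := alg_char_two U α
  set q := 2 ^ α with hq
  have hUq' : U ^ q = 1 + (U - 1) ^ q := by rw [hUq]; abel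
  set Z : (I → K) →ₗ[K] (I → K) := 1 + Y with hZ
  have hUι : ∀ x, (U ^ q) (ι x) = ι (Z x) := by
    intro x
    simp only [hUq', hZ, LinearMap.add_apply, Module.End.one_apply, map_add, hι]
  have hpU : ∀ x, p ((U ^ q) x) = Z (p x) := by
    intro x
    simp only [hUq', hZ, LinearMap.add_apply, Module.End.one_apply, map_add, hp]
  have hp0 : ∀ m, m < q - 1 → ∀ x, p ((U ^ m) (ι x)) = 0 := by
    intro m hm x
    simpa using (pUι U q ι p h0 h1 m).1 0 (by omega) x
  have hp1 : ∀ x, p ((U ^ (q - 1)) (ι x)) = x := by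
    intro x
    simpa using (pUι U q ι p h0 h1 (q - 1)).2 0 (by omega) x
  have hpq : ∀ m, q ≤ m → m < q + (q - 1) → ∀ x, p ((U ^ m) (ι x)) = 0 := by
    intro m hm hm2 x
    obtain ⟨k, rfl⟩ := Nat.exists_eq_add_of_le hm
    rw [pow_add, Module.End.mul_apply, hpU, hp0 k (by omega), map_zero]
  have hZpr : ∀ x, Z (pr x) = pr (Z x) := by
    intro x
    simp only [hZ, LinearMap.add_apply, Module.End.one_apply, map_add, hprY]
  let E : ((I → K) →ₗ[K] (I → K)) → (V →ₗ[K] V) := fun a => ι ∘ₗ a ∘ₗ p ∘ₗ (U ^ (q - 1))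
  have hE : ∀ a x, E a x = ι (a (p ((U ^ (q - 1)) x))) := fun a x => rfl
  have hEc : ∀ a, (∀ x, Z (a x) = a (Z x)) → U ^ q * E a = E a * U ^ q := by
    intro a ha
    ext1 x
    rw [Module.End.mul_apply, Module.End.mul_apply, hE, hE, hUι, ha, ← hpU,
      ← Module.End.mul_apply, ← Module.End.mul_apply, ← pow_add, ← pow_add, add_comm]
  have htr : ∀ (a : (I → K) →ₗ[K] (I → K)), LinearMap.trace K V (E a) = LinearMap.trace K _ a := by
    intro a
    have := LinearMap.trace_comp_comm' (R := K) ι (a ∘ₗ p ∘ₗ (U ^ (q - 1)))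
    change LinearMap.trace K V (ι ∘ₗ a ∘ₗ p ∘ₗ (U ^ (q - 1))) = _
    rw [← this]
    congr 1
    ext1 x
    simp only [LinearMap.comp_apply, hp1]
  have hYnil : ∀ m x, ι ((Y ^ m) x) = ((U - 1) ^ (q * m)) (ι x) := by
    intro m
    induction m with
    | zero => simp
    | succ m ih =>
      intro x
      rw [pow_succ, Module.End.mul_apply, ih, ← hι, ← Module.End.mul_apply, ← pow_add]
      rfl
  have hYN : Y ^ N = 0 := by
    ext1 x
    rw [← h1 ((Y ^ N) x), hYnil, mul_comm q N, pow_mul, hT, zero_pow hq0.ne']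
    simp
  have hcomm : Commute Y pr := by
    change Y * pr = pr * Y
    ext1 x
    exact (hprY x).symm
  have hnil : IsNilpotent (Y * pr) := hcomm.isNilpotent_mul_right ⟨N, hYN⟩
  have htrY : LinearMap.trace K (I → K) (Y * pr) = 0 :=
    (LinearMap.isNilpotent_trace_of_isNilpotent hnil).eq_zero
  refine ⟨E LinearMap.id, E pr, U ^ (q / 2) * E pr, ?_, ?_, hEc pr hZpr, ?_, ?_⟩
  · have hc := nrm_comm U Ui hU1 hU2 q (E LinearMap.id) (hEc _ (fun x => rfl))
    ext1 x
    refine hD _ ?_ ?_ x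
    · intro x
      have := congrArg (fun f : V →ₗ[K] V => f x) hc
      simp only [Module.End.mul_apply] at this
      simp only [LinearMap.sub_apply, Module.End.one_apply, map_sub, this]
    · intro x
      unfold nrm
      rw [LinearMap.sum_apply, Finset.sum_eq_single 0]
      · simp [hE, hp1]
      · intro i hi hi0
        rw [Finset.mem_range] at hi
        rw [Module.End.mul_apply, Module.End.mul_apply, hE, ← Module.End.mul_apply (U ^ (q - 1)),
          pow_mul_inv U Ui hU1 _ _ (by omega), hp0 _ (by omega)]
        simp
      · intro h; simp at h; omega
  · rw [htr, LinearMap.trace_id, ← hcard, Nat.mul_div_cancel _ hq0, finrank_fintype_fun_eq_card]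
  · rw [htr, hr, hr1]
  · intro hα
    obtain ⟨h, hh⟩ : ∃ h, q = 2 * h := ⟨2 ^ (α - 1), by rw [hq, ← pow_succ']; congr 1; omega⟩
    have hq2 : q / 2 = h := by omega
    rw [hq2]
    refine ⟨?_, ?_, ?_⟩
    · rw [← mul_assoc, ← pow_add, add_comm, pow_add, mul_assoc, hEc pr hZpr, mul_assoc]
    · rw [LinearMap.trace_mul_comm]
      have : E pr * U ^ h = ι ∘ₗ (pr ∘ₗ p ∘ₗ (U ^ (q - 1)) ∘ₗ (U ^ h)) := rfl
      rw [this, ← LinearMap.trace_comp_comm']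
      refine (congrArg _ ?_).trans (map_zero (LinearMap.trace K (I → K)))
      ext1 x
      simp only [LinearMap.comp_apply]
      rw [← Module.End.mul_apply (U ^ (q - 1)), ← pow_add, hpq _ (by omega) (by omega)]
      simp
    · have hterm : nrm U Ui q (U ^ h * E pr) * (U ^ h * E pr) = E (Z * pr) := by
        unfold nrm
        rw [Finset.sum_mul, Finset.sum_eq_single h]
        · have e1 : U ^ h * (U ^ h * E pr) * Ui ^ h * (U ^ h * E pr) =
              U ^ q * (E pr * E pr) := by
            have : Ui ^ h * U ^ h = 1 := inv_pow_mul Ui U hU2 h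
            calc _ = (U ^ h * U ^ h) * E pr * (Ui ^ h * U ^ h) * E pr := by
                    simp only [mul_assoc]
              _ = _ := by rw [this, mul_one, ← pow_add, ← two_mul, ← hh, mul_assoc]
          rw [e1]
          ext1 x
          rw [Module.End.mul_apply, Module.End.mul_apply, hE, hE, hp1, hpr2, hUι, hE]
          rfl
        · intro i hi hih
          rw [Finset.mem_range] at hi
          have e1 : ∀ x, p ((U ^ (q - 1)) ((Ui ^ i) ((U ^ h) (ι x)))) = 0 := by
            intro x
            rw [← Module.End.mul_apply (U ^ (q - 1)), pow_mul_inv U Ui hU1 _ _ (by omega),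
              ← Module.End.mul_apply, ← pow_add]
            by_cases hi2 : i < h
            · exact hpq _ (by omega) (by omega) x
            · exact hp0 _ (by omega) x
          ext1 x
          simp only [Module.End.mul_apply, hE, e1, map_zero, LinearMap.zero_apply]
        · intro hh2; simp at hh2; omega
      rw [hterm, htr, hZ, add_mul, one_mul, map_add, htrY, hr, hr1, add_zero]

lemma nrm_mul (U Ui : V →ₗ[K] V) (hU1 : U * Ui = 1) (hU2 : Ui * U = 1) (q : ℕ)
    (δ y : V →ₗ[K] V) (hy : U * y = y * U) : nrm U Ui q (δ * y) = nrm U Ui q δ * y := by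
  have h : Commute Ui y := by
    change Ui * y = y * Ui
    calc Ui * y = Ui * (y * U) * Ui := by rw [mul_assoc, mul_assoc, hU1, mul_one]
      _ = y * Ui := by rw [← hy, ← mul_assoc, hU2, one_mul]
  unfold nrm
  rw [Finset.sum_mul]
  refine Finset.sum_congr rfl fun i _ => ?_
  have := (h.pow_left i).eq
  simp only [mul_assoc, this]

end Elements

section Transport

open TensorProduct

variable {K : Type*} [Field K] {V : Type*} [AddCommGroup V] [Module K V] [FiniteDimensional K V]

/-- The identification of `V ⊗ V*` with `End V`. -/
noncomputable def toEnd (K : Type*) [Field K] (V : Type*) [AddCommGroup V] [Module K V] [FiniteDimensional K V] :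
    V ⊗[K] Module.Dual K V ≃ₗ[K] (V →ₗ[K] V) :=
  (TensorProduct.comm K V (Module.Dual K V)).trans (dualTensorHomEquiv K V V)

lemma toEnd_tmul (v : V) (f : Module.Dual K V) (x : V) : toEnd K V (v ⊗ₜ[K] f) x = f x • v := by
  simp [toEnd]

lemma toEnd_tmul' (v : V) (f : Module.Dual K V) : toEnd K V (v ⊗ₜ[K] f) = f.smulRight v := by
  ext x; simp [toEnd_tmul]

lemma toEnd_conj (u : V ≃ₗ[K] V) (x : V ⊗[K] Module.Dual K V) :
    toEnd K V ((TensorProduct.congr u u.symm.dualMap) x) =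
      (u : V →ₗ[K] V) * toEnd K V x * (u.symm : V →ₗ[K] V) := by
  induction x using TensorProduct.induction_on with
  | zero => simp
  | tmul v f =>
    ext y
    simp [toEnd_tmul, Module.End.mul_apply]
  | add x y hx hy => simp only [map_add, hx, hy, mul_add, add_mul]

lemma trace_tmul (v : V) (f : Module.Dual K V) :
    LinearMap.trace K V (toEnd K V (v ⊗ₜ[K] f)) = f v := by
  rw [toEnd_tmul', LinearMap.trace_smulRight]

lemma form_eq (bV : V ⊗[K] Module.Dual K V →ₗ[K] V ⊗[K] Module.Dual K V →ₗ[K] K)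
    (hbV : ∀ (v : V) (f : Module.Dual K V) (v' : V) (f' : Module.Dual K V),
      bV (v ⊗ₜ[K] f) (v' ⊗ₜ[K] f') = f v' * f' v + f v * f' v') (x y : V ⊗[K] Module.Dual K V) :
    bV x y = LinearMap.trace K V (toEnd K V x * toEnd K V y) +
      LinearMap.trace K V (toEnd K V x) * LinearMap.trace K V (toEnd K V y) := by
  induction x using TensorProduct.induction_on with
  | zero => simp
  | add x y hx hy => simp only [map_add, LinearMap.add_apply, hx, hy, add_mul]; ring
  | tmul v f =>
    induction y using TensorProduct.induction_on with
    | zero => simp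
    | add x y hx hy => simp only [map_add, hx, hy, mul_add]; ring
    | tmul v' f' =>
      rw [hbV, trace_tmul, trace_tmul]
      have : toEnd K V (v ⊗ₜ[K] f) * toEnd K V (v' ⊗ₜ[K] f') = toEnd K V (v ⊗ₜ[K] (f v' • f')) := by
        ext y
        simp [toEnd_tmul, Module.End.mul_apply, smul_smul, mul_comm]
      rw [this, trace_tmul]
      simp

lemma toEnd_pow (u : V ≃ₗ[K] V) (i : ℕ) (x : V ⊗[K] Module.Dual K V) :
    toEnd K V (((TensorProduct.congr u u.symm.dualMap).toLinearMap ^ i) x) =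
      (u : V →ₗ[K] V) ^ i * toEnd K V x * (u.symm : V →ₗ[K] V) ^ i := by
  induction i with
  | zero => simp
  | succ i ih =>
    rw [pow_succ', Module.End.mul_apply]
    change toEnd K V ((TensorProduct.congr u u.symm.dualMap) _) = _
    rw [toEnd_conj, ih, pow_succ' (u : V →ₗ[K] V), pow_succ (u.symm : V →ₗ[K] V)]
    simp only [mul_assoc]

lemma toEnd_gamma {n : ℕ} (e : Basis (Fin n) K V) :
    toEnd K V (∑ i, e i ⊗ₜ[K] e.coord i) = 1 := by
  ext x
  rw [map_sum, LinearMap.sum_apply]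
  simp only [toEnd_tmul, Basis.coord_apply, Module.End.one_apply]
  exact e.sum_repr x

end Transport

open TensorProduct in
/-- Theorem A of the paper: Jordan block multiplicities and ε-invariants of a
unipotent `u ∈ SL(V)` on the subquotient `⟨γ_V⟩^⊥/⟨γ_V⟩` of `V ⊗ V*` (realizing
`L(ϖ₁ + ϖ_{n-1})`), in terms of those on `V ⊗ V*`. -/
theorem jordan_and_eps_on_subquotient_of_tensor_dual
    (K : Type*) [Field K] [IsAlgClosed K] [CharP K 2]
    (V : Type*) [AddCommGroup V] [Module K V] [FiniteDimensional K V]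
    (n : ℕ) (hn : 2 ≤ n) (hdim : Module.finrank K V = n)
    (u : V ≃ₗ[K] V) (huni : IsUnipotent K (u : V →ₗ[K] V))
    -- the invariant alternating form b_V on V ⊗ V*, determined on pure tensors
    (bV : V ⊗[K] Module.Dual K V →ₗ[K] V ⊗[K] Module.Dual K V →ₗ[K] K)
    (hbV : ∀ (v : V) (f : Module.Dual K V) (v' : V) (f' : Module.Dual K V),
      bV (v ⊗ₜ[K] f) (v' ⊗ₜ[K] f') = f v' * f' v + f v * f' v')
    -- the canonical fixed vector γ_V = ∑ eᵢ ⊗ eᵢ*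
    (γ : V ⊗[K] Module.Dual K V) (e : Basis (Fin n) K V)
    (hγ : γ = ∑ i, e i ⊗ₜ[K] e.coord i)
    -- the subquotient ⟨γ⟩^⊥/⟨γ⟩, presented as a quotient Q of the submodule ⟨γ⟩^⊥ = ker (bV.flip γ)
    (Q : Type*) [AddCommGroup Q] [Module K Q]
    (π : ↥(LinearMap.ker (bV.flip γ)) →ₗ[K] Q)
    (hπsurj : Function.Surjective π)
    (hπker : ∀ x : ↥(LinearMap.ker (bV.flip γ)),
      π x = 0 ↔ (x : V ⊗[K] Module.Dual K V) ∈ Submodule.span K {γ})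
    -- the induced unipotent automorphism and the induced bilinear form on Q
    (uQ : Q →ₗ[K] Q)
    (huQ : ∀ x y : ↥(LinearMap.ker (bV.flip γ)),
      (y : V ⊗[K] Module.Dual K V) =
        (TensorProduct.congr u u.symm.dualMap) (x : V ⊗[K] Module.Dual K V) →
      π y = uQ (π x))
    (bQ : Q →ₗ[K] Q →ₗ[K] K)
    (hbQ : ∀ x y : ↥(LinearMap.ker (bV.flip γ)),
      bQ (π x) (π y) = bV (x : V ⊗[K] Module.Dual K V) (y : V ⊗[K] Module.Dual K V))
    -- α = ν₂ of the gcd of the Jordan block sizes of u on V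
    (α : ℕ)
    (hα1 : ∀ m : ℕ, 1 ≤ m → jordanMult K ((u : V →ₗ[K] V) - 1) m ≠ 0 → 2 ^ α ∣ m)
    (hα2 : ∃ m : ℕ, 1 ≤ m ∧ jordanMult K ((u : V →ₗ[K] V) - 1) m ≠ 0 ∧ ¬ 2 ^ (α + 1) ∣ m) :
    ∀ lam lam' epsl epsl' : ℕ → ℕ,
      lam = jordanMult K ((TensorProduct.congr u u.symm.dualMap).toLinearMap - 1) →
      lam' = jordanMult K (uQ - 1) →
      epsl = eps K ((TensorProduct.congr u u.symm.dualMap).toLinearMap - 1) bV →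
      epsl' = eps K (uQ - 1) bQ →
      ((¬ 2 ∣ n → (lam' 1 + 1 = lam 1 ∧ ∀ d, 1 < d → lam' d = lam d)) ∧
       (2 ∣ n → α = 0 → (lam' 1 + 2 = lam 1 ∧ ∀ d, 1 < d → lam' d = lam d)) ∧
       (2 ∣ n → 0 < α → 2 ∣ n / 2 ^ α →
         (lam' (2 ^ α) + 2 = lam (2 ^ α) ∧ lam' (2 ^ α - 1) = 2 ∧
          ∀ d, 1 ≤ d → d ≠ 2 ^ α → d ≠ 2 ^ α - 1 → lam' d = lam d)) ∧
       (2 ∣ n → 1 < α → ¬ 2 ∣ n / 2 ^ α →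
         (lam' (2 ^ α) + 1 = lam (2 ^ α) ∧ lam' (2 ^ α - 2) = 1 ∧
          ∀ d, 1 ≤ d → d ≠ 2 ^ α → d ≠ 2 ^ α - 2 → lam' d = lam d)) ∧
       (2 ∣ n → α = 1 → ¬ 2 ∣ n / 2 →
         (lam' 2 + 1 = lam 2 ∧ ∀ d, 1 ≤ d → d ≠ 2 → lam' d = lam d)) ∧
       ((2 ∣ n ∧ 1 < α ∧ ¬ 2 ∣ n / 2 ^ α) →
         (epsl (2 ^ α - 2) = 0 ∧ epsl' (2 ^ α - 2) = 1 ∧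
          ∀ d, 1 ≤ d → d ≠ 2 ^ α - 2 → epsl' d = epsl d)) ∧
       (¬ (2 ∣ n ∧ 1 < α ∧ ¬ 2 ∣ n / 2 ^ α) → ∀ d, 1 ≤ d → epsl' d = epsl d)) := by
  intro lam lam' epsl epsl' rfl' rfl'' rfl3 rfl4
  subst rfl' rfl'' rfl3 rfl4
  obtain ⟨N, hN⟩ := huni
  have h2 : (2 : K) = 0 := CharTwo.two_eq_zero
  have cast0 : ∀ m : ℕ, ((m : K) = 0 ↔ 2 ∣ m) := fun m => CharP.cast_eq_zero_iff K 2 m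
  have hb := form_eq bV hbV
  have hsymm : ∀ x y, bV x y = bV y x := by
    intro x y
    rw [hb, hb, LinearMap.trace_mul_comm, mul_comm (LinearMap.trace K V _)]
  have halt : ∀ x, bV x x = 0 := by
    intro x
    induction x using TensorProduct.induction_on with
    | zero => simp
    | tmul v f => rw [hbV]; exact CharTwo.add_self_eq_zero _
    | add x y hx hy =>
      simp only [map_add, LinearMap.add_apply, hx, hy]
      rw [hsymm y x, zero_add, add_zero]; exact CharTwo.add_self_eq_zero _
  set g := (TensorProduct.congr u u.symm.dualMap).toLinearMap with hg
  set U : V →ₗ[K] V := (u : V →ₗ[K] V) with hU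
  set Ui : V →ₗ[K] V := (u.symm : V →ₗ[K] V) with hUi
  have hU1 : U * Ui = 1 := by ext x; simp [hU, hUi, Module.End.mul_apply]
  have hU2 : Ui * U = 1 := by ext x; simp [hU, hUi, Module.End.mul_apply]
  have hΦg : ∀ x, toEnd K V (g x) = U * toEnd K V x * Ui := toEnd_conj u
  have hΦpow : ∀ i x, toEnd K V ((g ^ i) x) = U ^ i * toEnd K V x * Ui ^ i := toEnd_pow u
  have hΦγ : toEnd K V γ = 1 := by rw [hγ]; exact toEnd_gamma e
  have htrg : ∀ x, LinearMap.trace K V (toEnd K V (g x)) = LinearMap.trace K V (toEnd K V x) := by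
    intro x
    rw [hΦg, LinearMap.trace_mul_comm, ← mul_assoc, hU2, one_mul]
  have hinv : ∀ x y, bV (g x) (g y) = bV x y := by
    intro x y
    rw [hb, hb, htrg, htrg, hΦg, hΦg]
    congr 1
    have : U * toEnd K V x * Ui * (U * toEnd K V y * Ui) =
        U * (toEnd K V x * toEnd K V y) * Ui := by
      calc _ = U * toEnd K V x * (Ui * U) * (toEnd K V y * Ui) := by simp only [mul_assoc]
        _ = _ := by rw [hU2, mul_one]; simp only [mul_assoc]
    rw [this, LinearMap.trace_mul_comm, ← mul_assoc, hU2, one_mul]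
  have hgγ : g γ = γ := by
    apply (toEnd K V).injective
    rw [hΦg, hΦγ, mul_one, hU1]
  have hbγ : ∀ x, bV γ x = ((n : K) + 1) * LinearMap.trace K V (toEnd K V x) := by
    intro x
    rw [hb, hΦγ, one_mul, LinearMap.trace_one, hdim]; ring
  have hXP : ∀ x ∈ LinearMap.ker (bV.flip γ), (g - 1) x ∈ LinearMap.ker (bV.flip γ) := by
    intro x hx
    rw [LinearMap.mem_ker, LinearMap.flip_apply] at hx ⊢
    rw [LinearMap.sub_apply, Module.End.one_apply, map_sub, LinearMap.sub_apply, hx, sub_zero]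
    rw [← hx, ← hinv x γ, hgγ]
  have hXQ : ∀ x : ↥(LinearMap.ker (bV.flip γ)), (uQ - 1) (π x) = π ⟨(g - 1) x, hXP _ x.2⟩ := by
    intro x
    have hgx : g x ∈ LinearMap.ker (bV.flip γ) := by
      have := Submodule.add_mem _ (hXP _ x.2) x.2
      simpa using this
    have h := huQ x ⟨g x, hgx⟩ rfl
    rw [LinearMap.sub_apply, Module.End.one_apply, ← h, ← map_sub]
    rfl
  by_cases hn2 : 2 ∣ n
  swap
  · have hPtop : LinearMap.ker (bV.flip γ) = ⊤ := by
      rw [eq_top_iff]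
      intro x _
      rw [LinearMap.mem_ker, LinearMap.flip_apply, hsymm, hbγ]
      have : ((n + 1 : ℕ) : K) = 0 := (cast0 _).2 (by omega)
      push_cast at this
      rw [this, zero_mul]
    have hbγ' : ∀ x, bV x γ = 0 := by
      intro x
      have : x ∈ LinearMap.ker (bV.flip γ) := by rw [hPtop]; trivial
      exact this
    have hmain := abs_odd g bV (LinearMap.trace K V ∘ₗ (toEnd K V).toLinearMap) halt γ hgγ hbγ'
      (by
        change LinearMap.trace K V (toEnd K V γ) ≠ 0
        rw [hΦγ, LinearMap.trace_one, hdim, Ne, cast0]; exact hn2)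
      htrg _ hPtop Q π hπsurj hπker hXP (uQ - 1) hXQ bQ hbQ
    exact ⟨fun _ => hmain.1, fun h => absurd h hn2, fun h => absurd h hn2, fun h => absurd h hn2,
      fun h => absurd h hn2, fun h => absurd h.1 hn2, fun _ => hmain.2⟩
  have hn0 : (n : K) = 0 := (cast0 n).2 hn2
  have hbt : ∀ x, bV γ x = LinearMap.trace K V (toEnd K V x) := by
    intro x; rw [hbγ, hn0, zero_add, one_mul]
  have hP : LinearMap.ker (bV.flip γ) = LinearMap.ker (bV γ) := by
    ext x
    rw [LinearMap.mem_ker, LinearMap.mem_ker, LinearMap.flip_apply, hsymm]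
  obtain ⟨δ, z, w, hδ, hδt, hz, hzt, hw⟩ := exists_elems U Ui hU1 hU2 N hN α hα1 hα2
  obtain ⟨hg1, hg2⟩ := alg_char_two g α
  rw [hdim] at hδt
  have hfix : ∀ x : V →ₗ[K] V, U ^ (2 ^ α) * x = x * U ^ (2 ^ α) →
      ((g - 1) ^ (2 ^ α) : V ⊗[K] Module.Dual K V →ₗ[K] V ⊗[K] Module.Dual K V) ((toEnd K V).symm x) = 0 := by
    intro x hx
    apply (toEnd K V).injective
    rw [hg1, LinearMap.sub_apply, Module.End.one_apply, map_sub, hΦpow, LinearEquiv.apply_symm_apply, hx,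
      mul_assoc, inv_pow_mul U Ui hU1, mul_one, sub_self, map_zero]
  have hnrm : ∀ x : V ⊗[K] Module.Dual K V, toEnd K V (((g - 1) ^ (2 ^ α - 1) : V ⊗[K] Module.Dual K V →ₗ[K] V ⊗[K] Module.Dual K V) x) =
        nrm U Ui (2 ^ α) (toEnd K V x) := by
    intro x
    rw [hg2, LinearMap.sum_apply, map_sum]
    simp only [hΦpow, nrm]
  rcases Nat.eq_zero_or_pos α with hα | hα
  · have hz0 := hfix z hz
    rw [hα, pow_zero, pow_one] at hz0
    have hmain := abs_even_zero g bV hinv hsymm halt γ hgγ ((toEnd K V).symm z) hz0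
      (by rw [hbt, LinearEquiv.apply_symm_apply, hzt]) _ hP Q π hπsurj hπker hXP (uQ - 1) hXQ bQ hbQ
    exact ⟨fun h => absurd hn2 h, fun _ _ => hmain.1, fun _ h => by omega, fun _ h => by omega,
      fun _ h => by omega, fun h => by omega, fun _ => hmain.2⟩
  obtain ⟨hw1, hwt, hww⟩ := hw hα
  have hq2 : 2 ∣ 2 ^ α := dvd_pow_self 2 (by omega)
  have hq : 2 ≤ 2 ^ α := Nat.le_of_dvd (by positivity) hq2
  have hmain := abs_even_pos g bV hinv hsymm halt γ hgγ (2 ^ α) hq hq2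
    ((toEnd K V).symm δ)
    (by
      apply (toEnd K V).injective
      rw [hnrm, LinearEquiv.apply_symm_apply, hδ, hΦγ])
    ((toEnd K V).symm z) (hfix z hz) (by rw [hbt, LinearEquiv.apply_symm_apply, hzt])
    ((toEnd K V).symm w) (hfix w hw1) (by rw [hbt, LinearEquiv.apply_symm_apply, hwt])
    (by
      rw [hb, hnrm, LinearEquiv.apply_symm_apply, hww, hwt, mul_zero, add_zero]
      exact one_ne_zero)
    (by
      intro y hy
      refine ⟨(toEnd K V).symm (δ * toEnd K V y), ?_⟩
      apply (toEnd K V).injective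
      have hy2 : U * toEnd K V y = toEnd K V y * U := by
        have h3 : g y = y := by
          rw [LinearMap.sub_apply, Module.End.one_apply] at hy
          exact sub_eq_zero.1 hy
        have h4 := hΦg y
        rw [h3] at h4
        calc U * toEnd K V y = U * toEnd K V y * Ui * U := by rw [mul_assoc _ Ui, hU2, mul_one]
          _ = _ := by rw [← h4]
      rw [hnrm, LinearEquiv.apply_symm_apply, nrm_mul U Ui hU1 hU2 _ _ _ hy2, hδ, one_mul])
    _ hP Q π hπsurj hπker hXP (uQ - 1) hXQ bQ hbQ
  have hbδ : bV γ ((toEnd K V).symm δ) = 0 ↔ 2 ∣ n / 2 ^ α := by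
    rw [hbt, LinearEquiv.apply_symm_apply, hδt, cast0]
  rw [Ne, hbδ] at hmain
  obtain ⟨m1, m2, m3, m4⟩ := hmain
  have hq4 : 1 < α → 2 < 2 ^ α := by
    intro h
    calc 2 = 2 ^ 1 := rfl
      _ < 2 ^ α := Nat.pow_lt_pow_right (by norm_num) h
  refine ⟨fun h => absurd hn2 h, fun _ h => by omega, fun _ _ h => m1 h, ?_, ?_, ?_, ?_⟩
  · intro _ h1 h
    exact ⟨(m2 h).1, (m2 h).2.1 (hq4 h1), (m2 h).2.2⟩
  · intro _ h1 h
    subst h1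
    exact ⟨(m2 h).1, fun d hd hd2 => (m2 h).2.2 d hd hd2 (by simp; omega)⟩
  · rintro ⟨_, h1, h⟩
    exact ⟨(m3 h (hq4 h1)).1, (m3 h (hq4 h1)).2, fun d hd hd2 => m4 d hd (fun _ => hd2)⟩
  · intro h d hd
    refine m4 d hd (fun h3 => ?_)
    have h1 : α = 1 := by
      by_contra h5
      exact h ⟨hn2, by omega, h3⟩
    subst h1
    simp; omega
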